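/- arXiv:2111.06993 — 3 statements merged into one kernel-verified Lean document; each statement's English description precedes it below -/
import Mathlib

section
/- Let G be a uniform grid, let I = [c,d] ⊆ [0,N] be an interval, and let E = {w_t : t ∈ I} be I-compatible. Then rank(Ev_{I,E}) = Σ_{t∈I} min{[G choose t], [G choose w_t]}. -/
open scoped Classical

/-- The number of grid points of weight `j`. -/
noncomputable def layerCard (n : ℕ) (k : Fin n → ℕ) (j : ℕ) : ℕ :=
  (Finset.univ.filter (fun x : ∀ i, Fin (k i) => ∑ i, (x i : ℕ) = j)).card

/-- The evaluation matrix `Ev_{D,E}` with entries `Y^(α)(β) = α!·C(β,α)`. -/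
noncomputable def EvMat (n : ℕ) (k : Fin n → ℕ) (D E : Finset ℕ) :
    Matrix {α : ∀ i, Fin (k i) // (∑ i, (α i : ℕ)) ∈ D}
      {β : ∀ i, Fin (k i) // (∑ i, (β i : ℕ)) ∈ E} ℝ := fun α β =>
  ∏ i, ∏ t ∈ Finset.range (α.1 i : ℕ), (((β.1 i : ℕ) : ℝ) - (t : ℝ))

open Matrix in
theorem aux_rank_blockDiagonal {o : Type*} [Fintype o] [DecidableEq o] {m' : o → Type*}
    [∀ i, Fintype (m' i)] [∀ i, DecidableEq (m' i)] (A : ∀ i, Matrix (m' i) (m' i) ℝ) :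
    (blockDiagonal' A).rank = ∑ i, (A i).rank := by
  have h : ∀ i, ∃ (L L' : Matrix (m' i) (m' i) ℝ) (D : m' i → ℝ), IsUnit L ∧ IsUnit L' ∧
      A i = L * diagonal D * L' := by
    intro i
    obtain ⟨L, L', D, hM⟩ :=
      Matrix.Pivot.exists_list_transvec_mul_diagonal_mul_list_transvec (A i)
    refine ⟨_, _, D, ?_, ?_, hM⟩
    · rw [isUnit_iff_isUnit_det]; simp
    · rw [isUnit_iff_isUnit_det]; simp
  choose L L' D hL hL' hA using h
  have hu : ∀ M : ∀ i, Matrix (m' i) (m' i) ℝ, (∀ i, IsUnit (M i)) →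
      IsUnit (blockDiagonal' M) := by
    intro M hM
    have : IsUnit M := Pi.isUnit_iff.2 hM
    exact this.map (blockDiagonal'RingHom m' ℝ)
  have e : blockDiagonal' A = blockDiagonal' L * diagonal (fun s : Σ i, m' i => D s.1 s.2)
      * blockDiagonal' L' := by
    rw [← blockDiagonal'_diagonal, ← blockDiagonal'_mul, ← blockDiagonal'_mul]
    congr 1; funext i; exact hA i
  have e2 : ∀ i, (A i).rank = Fintype.card {j // D i j ≠ 0} := by
    intro i
    rw [hA i, rank_mul_eq_left_of_isUnit_det _ _ ((isUnit_iff_isUnit_det _).1 (hL' i)),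
      rank_mul_eq_right_of_isUnit_det _ _ ((isUnit_iff_isUnit_det _).1 (hL i)), rank_diagonal]
  rw [e, rank_mul_eq_left_of_isUnit_det _ _ ((isUnit_iff_isUnit_det _).1 (hu _ hL')),
    rank_mul_eq_right_of_isUnit_det _ _ ((isUnit_iff_isUnit_det _).1 (hu _ hL)), rank_diagonal]
  simp_rw [e2]
  rw [← Fintype.card_sigma]
  apply Fintype.card_congr
  exact ⟨fun s => ⟨s.1.1, s.1.2, s.2⟩, fun s => ⟨⟨s.1, s.2.1⟩, s.2.2⟩, fun _ => rfl, fun _ => rfl⟩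

open Matrix in
theorem aux_rank_pad {m : Type*} [Fintype m] [DecidableEq m] (M : Matrix m m ℝ)
    (p q : m → Prop) [DecidablePred p] [DecidablePred q]
    (h : ∀ i j, ¬ (p i ∧ q j) → M i j = 0) :
    (M.submatrix (Subtype.val : {i // p i} → m) (Subtype.val : {i // q i} → m)).rank = M.rank := by
  apply le_antisymm
  · exact rank_submatrix_le _ _ _
  · have e : M = ((1 : Matrix m m ℝ).submatrix id (Subtype.val : {i // p i} → m)) *
        (M.submatrix (Subtype.val : {i // p i} → m) (Subtype.val : {i // q i} → m)) *
        ((1 : Matrix m m ℝ).submatrix (Subtype.val : {i // q i} → m) id) := by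
      ext i j
      simp only [mul_apply, submatrix_apply, id, one_apply]
      by_cases hj : q j
      · rw [Finset.sum_eq_single ⟨j, hj⟩]
        · by_cases hi : p i
          · rw [Finset.sum_eq_single ⟨i, hi⟩]
            · simp
            · intro b _ hb
              rw [if_neg, zero_mul]
              rintro rfl; exact hb rfl
            · simp
          · rw [h i j (by tauto), Finset.sum_eq_zero, zero_mul]
            intro b _
            rw [if_neg, zero_mul]
            rintro rfl; exact hi b.2
        · intro b _ hb
          rw [if_neg, mul_zero]
          intro hh; exact hb (Subtype.ext hh)
        · simp
      · rw [h i j (by tauto), Finset.sum_eq_zero]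
        intro b _
        rw [if_neg, mul_zero]
        rintro rfl; exact hj b.2
    calc M.rank = _ := by rw [← e]
      _ ≤ _ := rank_mul_le_left _ _
      _ ≤ _ := rank_mul_le_right _ _

/-- The string block. -/
noncomputable def strBlock (I E J : Finset ℕ) : Matrix J J ℝ := fun v t =>
  if (v : ℕ) ∈ E ∧ (t : ℕ) ∈ I ∧ (t : ℕ) ≤ v then 1 / (((v : ℕ) - (t : ℕ)).factorial : ℝ) else 0

open Matrix in
theorem aux_det (m a : ℕ) (f : Fin m → ℕ) (hf : Function.Injective f) (ha : ∀ i, a ≤ f i) :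
    (Matrix.of (fun i j : Fin m => if a + (j : ℕ) ≤ f i then
      1 / ((f i - (a + (j : ℕ))).factorial : ℝ) else 0)).det ≠ 0 := by
  have e : (Matrix.of (fun i j : Fin m => if a + (j : ℕ) ≤ f i then
      1 / ((f i - (a + (j : ℕ))).factorial : ℝ) else 0)) =
      diagonal (fun i => 1 / ((f i - a).factorial : ℝ)) *
      Matrix.of (fun i j : Fin m => (descPochhammer ℝ (j : ℕ)).eval (((f i - a : ℕ)) : ℝ)) := by
    ext i j
    simp only [diagonal_mul, of_apply]
    rw [descPochhammer_eval_eq_descFactorial]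
    split_ifs with h
    · have h2 := Nat.factorial_mul_descFactorial (n := f i - a) (k := j) (by omega)
      have h3 : f i - a - j = f i - (a + j) := by omega
      rw [h3] at h2
      rw [← h2]
      have := Nat.factorial_ne_zero (f i - (a + j))
      have h5 : (f i - a).descFactorial j ≠ 0 := by
        rw [Ne, Nat.descFactorial_eq_zero_iff_lt]; omega
      push_cast
      field_simp
    · have := ha i
      rw [Nat.descFactorial_eq_zero_iff_lt.2 (by omega)]; simp
  rw [e, det_mul, det_diagonal, ← det_eval_matrixOfPolynomials_eq_det_vandermonde
    (fun i => ((f i - a : ℕ) : ℝ)) (fun j => descPochhammer ℝ (j : ℕ))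
    (fun i => descPochhammer_natDegree ℝ i) (fun i => monic_descPochhammer ℝ i)]
  apply mul_ne_zero
  · apply Finset.prod_ne_zero_iff.2
    intro i _
    have := Nat.factorial_ne_zero (f i - a)
    positivity
  · rw [det_vandermonde_ne_zero_iff]
    intro i j hij
    apply hf
    have : f i - a = f j - a := by
      dsimp only at hij
      exact_mod_cast hij
    have := ha i
    have := ha j
    omega

open Matrix in
theorem aux_str_rank (c d N r : ℕ) (w : ℕ → ℕ)
    (hdistinct : Set.InjOn w (Finset.Icc c d))
    (hge : ∀ t ∈ Finset.Icc c d, t ≤ w t)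
    (hbig : ∀ t ∈ Finset.Icc c d, w t ≠ t → d < w t)
    (hdec : ∀ s ∈ Finset.Icc c d, ∀ t ∈ Finset.Icc c d, s < t →
      w s ∉ Finset.Icc c d → w t ∉ Finset.Icc c d → w t < w s) :
    (strBlock (Finset.Icc c d) ((Finset.Icc c d).image w) (Finset.Icc r (N - r))).rank =
      ((Finset.Icc c d).filter (fun t => t ∈ Finset.Icc r (N - r) ∧
        w t ∈ Finset.Icc r (N - r))).card := by
  set I := Finset.Icc c d with hI
  set J := Finset.Icc r (N - r) with hJ
  set E := I.image w with hE
  set R := I.filter (· ∈ J) with hR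
  set C := E.filter (· ∈ J) with hC
  set SC := I.filter (fun t => w t ∈ J) with hSC
  have hCc : C.card = SC.card := by
    have : C = SC.image w := by
      ext v
      simp only [hC, hSC, hE, Finset.mem_filter, Finset.mem_image]
      constructor
      · rintro ⟨⟨t, ht, rfl⟩, h⟩; exact ⟨t, ⟨ht, h⟩, rfl⟩
      · rintro ⟨t, ⟨ht, h⟩, rfl⟩; exact ⟨⟨t, ht, rfl⟩, h⟩
    rw [this, Finset.card_image_of_injOn]
    exact hdistinct.mono (by intro x hx; exact (Finset.mem_filter.1 hx).1)
  have hmin : (I.filter (fun t => t ∈ J ∧ w t ∈ J)).card = min R.card C.card := by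
    rw [hCc]
    have hcap : I.filter (fun t => t ∈ J ∧ w t ∈ J) = R ∩ SC := by
      ext t; simp only [hR, hSC, Finset.mem_filter, Finset.mem_inter]; tauto
    rw [hcap]
    have : R ⊆ SC ∨ SC ⊆ R := by
      by_contra hcon
      push Not at hcon
      obtain ⟨h1, h2⟩ := hcon
      rw [Finset.not_subset] at h1 h2
      obtain ⟨s, hs, hs'⟩ := h1
      obtain ⟨t, ht, ht'⟩ := h2
      simp only [hR, hSC, Finset.mem_filter, not_and] at hs hs' ht ht'
      have a1 := hs' hs.1
      have a2 := ht' ht.1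
      have b1 : w s ≠ s := fun h => a1 (by rw [h]; exact hs.2)
      have b2 : w t ≠ t := fun h => a2 (by rw [← h]; exact ht.2)
      have c1 := hbig s hs.1 b1
      have c2 := hbig t ht.1 b2
      have d1 := hge s hs.1
      have d2 := hge t ht.1
      obtain ⟨hs1, hs2⟩ := hs
      obtain ⟨ht1, ht2⟩ := ht
      have := hdec t ht1 s hs1
      simp only [hI, hJ, Finset.mem_Icc] at *
      omega
    rcases this with h | h
    · rw [Finset.inter_eq_left.2 h, min_eq_left (Finset.card_le_card h)]
    · rw [Finset.inter_eq_right.2 h, min_eq_right (Finset.card_le_card h)]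
  rw [hmin]
  apply le_antisymm
  · apply le_min
    · rw [← rank_transpose]
      refine (rank_le_card_of_support_subset _ (R.subtype (· ∈ J)) ?_).trans ?_
      · rw [Function.support_subset_iff']
        intro x hx
        funext v
        simp only [Finset.mem_coe, Finset.mem_subtype, hR, Finset.mem_filter] at hx
        have : (x : ℕ) ∉ I := fun h => hx ⟨h, x.2⟩
        simp [Matrix.row, strBlock, this]
      · rw [Finset.card_subtype]; exact Finset.card_filter_le _ _
    · refine (rank_le_card_of_support_subset _ (C.subtype (· ∈ J)) ?_).trans ?_
      · rw [Function.support_subset_iff']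
        intro x hx
        funext v
        simp only [Finset.mem_coe, Finset.mem_subtype, hC, Finset.mem_filter] at hx
        have : (x : ℕ) ∉ E := fun h => hx ⟨h, x.2⟩
        simp [Matrix.row, strBlock, this]
      · rw [Finset.card_subtype]; exact Finset.card_filter_le _ _
  · set m := min R.card C.card with hm
    have hRI : R = Finset.Icc (max c r) (min d (N - r)) := by
      ext t; simp only [hR, hI, hJ, Finset.mem_filter, Finset.mem_Icc]; omega
    have hmR : m ≤ min d (N - r) + 1 - max c r := by
      have h1 := min_le_left R.card C.card
      have h2 : R.card = min d (N - r) + 1 - max c r := by rw [hRI, Nat.card_Icc]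
      rw [← h2]; exact h1
    have hmC : m ≤ C.card := min_le_right _ _
    let f : Fin m → ℕ := fun i => C.orderEmbOfFin rfl (Fin.castLE hmC i)
    have hfC : ∀ i, f i ∈ C := fun i => Finset.orderEmbOfFin_mem _ _ _
    have hfi : Function.Injective f := fun i j h => by
      have := (C.orderEmbOfFin rfl).injective h
      exact Fin.castLE_injective hmC this
    have hfJ : ∀ i, f i ∈ J := fun i => (Finset.mem_filter.1 (hfC i)).2
    have hfE : ∀ i, f i ∈ E := fun i => (Finset.mem_filter.1 (hfC i)).1
    have hfa : ∀ i, max c r ≤ f i := by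
      intro i
      have h1 := hfJ i
      obtain ⟨t, ht, h2⟩ := Finset.mem_image.1 (hfE i)
      have h3 := hge t ht
      simp only [hI, hJ, Finset.mem_Icc] at h1 ht
      omega
    have hjR : ∀ j : Fin m, max c r + (j : ℕ) ∈ I ∧ max c r + (j : ℕ) ∈ J := by
      intro j
      have := j.2
      simp only [hI, hJ, Finset.mem_Icc]
      omega
    have hdet := aux_det m (max c r) f hfi hfa
    have := rank_submatrix_le (strBlock I E J) (fun i : Fin m => (⟨f i, hfJ i⟩ : J))
      (fun j : Fin m => (⟨max c r + (j : ℕ), (hjR j).2⟩ : J))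
    refine le_trans (le_of_eq ?_) this
    have e : (strBlock I E J).submatrix (fun i : Fin m => (⟨f i, hfJ i⟩ : J))
      (fun j : Fin m => (⟨max c r + (j : ℕ), (hjR j).2⟩ : J)) =
      (Matrix.of (fun i j : Fin m => if max c r + (j : ℕ) ≤ f i then
      1 / ((f i - (max c r + (j : ℕ))).factorial : ℝ) else 0)) := by
      ext i j
      simp [strBlock, hfE i, (hjR j).1]
    rw [e, rank_of_det_ne_zero hdet, Fintype.card_fin]

namespace Gd

variable {n : ℕ} {k : Fin n → ℕ}

/-- weight -/
def wt (x : ∀ i, Fin (k i)) : ℕ := ∑ i, (x i : ℕ)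

/-- lower a coordinate -/
def dn (i : Fin n) (x : ∀ i, Fin (k i)) : ∀ i, Fin (k i) :=
  Function.update x i ⟨(x i : ℕ) - 1, by have := (x i).2; omega⟩

/-- raise a coordinate -/
def up (i : Fin n) (x : ∀ i, Fin (k i)) : ∀ i, Fin (k i) :=
  Function.update x i (if h : (x i : ℕ) + 1 < k i then ⟨(x i : ℕ) + 1, h⟩ else x i)

theorem wt_update (i : Fin n) (x : ∀ i, Fin (k i)) (a : Fin (k i)) :
    wt (Function.update x i a) + (x i : ℕ) = wt x + (a : ℕ) := by
  unfold wt
  rw [← Finset.add_sum_erase _ _ (Finset.mem_univ i),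
    ← Finset.add_sum_erase (a := i) Finset.univ (fun i => (x i : ℕ)) (Finset.mem_univ i)]
  have : ∑ j ∈ Finset.univ.erase i, ((Function.update x i a j : Fin (k j)) : ℕ) =
      ∑ j ∈ Finset.univ.erase i, (x j : ℕ) := by
    apply Finset.sum_congr rfl
    intro j hj
    rw [Function.update_of_ne (Finset.ne_of_mem_erase hj)]
  rw [this, Function.update_self]
  omega

theorem wt_dn (i : Fin n) (x : ∀ i, Fin (k i)) (h : (x i : ℕ) ≠ 0) : wt (dn i x) + 1 = wt x := by
  have := wt_update i x ⟨(x i : ℕ) - 1, by have := (x i).2; omega⟩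
  unfold dn
  dsimp only at this
  omega

theorem wt_up (i : Fin n) (x : ∀ i, Fin (k i)) (h : (x i : ℕ) + 1 < k i) :
    wt (up i x) = wt x + 1 := by
  have := wt_update i x ⟨(x i : ℕ) + 1, h⟩
  unfold up
  rw [dif_pos h]
  dsimp only at this
  omega

theorem wt_le (x : ∀ i, Fin (k i)) : wt x ≤ ∑ i, (k i - 1) := by
  apply Finset.sum_le_sum
  intro i _
  have := (x i).2
  omega

/-- raising operator -/
def U : ((∀ i, Fin (k i)) → ℝ) →ₗ[ℝ] ((∀ i, Fin (k i)) → ℝ) where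
  toFun f := fun x => ∑ i, ((x i : ℕ) : ℝ) * f (dn i x)
  map_add' f g := by
    funext x; simp [mul_add, Finset.sum_add_distrib]
  map_smul' c f := by
    funext x; simp only [Pi.smul_apply, smul_eq_mul, RingHom.id_apply, Finset.mul_sum]
    apply Finset.sum_congr rfl; intros; ring

/-- lowering operator -/
def L : ((∀ i, Fin (k i)) → ℝ) →ₗ[ℝ] ((∀ i, Fin (k i)) → ℝ) where
  toFun f := fun x => ∑ i, ((k i : ℝ) - 1 - ((x i : ℕ) : ℝ)) * f (up i x)
  map_add' f g := by
    funext x; simp [mul_add, Finset.sum_add_distrib]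
  map_smul' c f := by
    funext x; simp only [Pi.smul_apply, smul_eq_mul, RingHom.id_apply, Finset.mul_sum]
    apply Finset.sum_congr rfl; intros; ring

theorem U_apply (f : (∀ i, Fin (k i)) → ℝ) (x : ∀ i, Fin (k i)) :
    U f x = ∑ i, ((x i : ℕ) : ℝ) * f (dn i x) := rfl

theorem L_apply (f : (∀ i, Fin (k i)) → ℝ) (x : ∀ i, Fin (k i)) :
    L f x = ∑ i, ((k i : ℝ) - 1 - ((x i : ℕ) : ℝ)) * f (up i x) := rfl

/-- functions supported on a layer -/
def lev (k : Fin n → ℕ) (j : ℕ) : Submodule ℝ ((∀ i, Fin (k i)) → ℝ) where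
  carrier := {f | ∀ x, wt x ≠ j → f x = 0}
  add_mem' := by
    intro f g hf hg x hx; simp [hf x hx, hg x hx]
  zero_mem' := by intro x _; rfl
  smul_mem' := by
    intro c f hf x hx; simp [hf x hx]

theorem U_mem {j : ℕ} {f : (∀ i, Fin (k i)) → ℝ} (hf : f ∈ lev k j) : U f ∈ lev k (j + 1) := by
  intro x hx
  rw [U_apply]
  apply Finset.sum_eq_zero
  intro i _
  by_cases h : (x i : ℕ) = 0
  · simp [h]
  · rw [hf, mul_zero]
    have := wt_dn i x h
    omega

theorem up_coef (i : Fin n) (x : ∀ i, Fin (k i)) (h : ¬ (x i : ℕ) + 1 < k i) :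
    ((k i : ℝ) - 1 - ((x i : ℕ) : ℝ)) = 0 := by
  have := (x i).2
  have h2 : k i = (x i : ℕ) + 1 := by omega
  have : (k i : ℝ) = ((x i : ℕ) : ℝ) + 1 := by exact_mod_cast h2
  rw [this]; ring

theorem L_mem {j : ℕ} {f : (∀ i, Fin (k i)) → ℝ} (hf : f ∈ lev k (j + 1)) : L f ∈ lev k j := by
  intro x hx
  rw [L_apply]
  apply Finset.sum_eq_zero
  intro i _
  by_cases h : (x i : ℕ) + 1 < k i
  · rw [hf, mul_zero]
    have := wt_up i x h
    omega
  · rw [up_coef i x h, zero_mul]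

theorem L_zero {f : (∀ i, Fin (k i)) → ℝ} (hf : f ∈ lev k 0) : L f = 0 := by
  funext x
  rw [L_apply]
  apply Finset.sum_eq_zero
  intro i _
  by_cases h : (x i : ℕ) + 1 < k i
  · rw [hf, mul_zero]
    have := wt_up i x h
    omega
  · rw [up_coef i x h, zero_mul]

theorem term_eq (f : (∀ i, Fin (k i)) → ℝ) (x : ∀ i, Fin (k i)) (i j : Fin n) :
    ((k i : ℝ) - 1 - ((x i : ℕ) : ℝ)) * (((up i x j : Fin (k j)) : ℕ) * f (dn j (up i x))) =
    (x j : ℕ) * (((k i : ℝ) - 1 - (((dn j x i : Fin (k i)) : ℕ) : ℝ)) * f (up i (dn j x))) +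
      if i = j then ((k i : ℝ) - 1 - 2 * (x i : ℕ)) * f x else 0 := by
  by_cases hij : i = j
  · subst hij
    rw [if_pos rfl]
    have e1 : (x i : ℕ) + 1 < k i → dn i (up i x) = x := by
      intro h
      unfold dn up
      rw [dif_pos h]
      simp
    have e2 : (x i : ℕ) ≠ 0 → up i (dn i x) = x := by
      intro h
      have h2 : (x i : ℕ) - 1 + 1 < k i := by have := (x i).2; omega
      unfold dn up
      simp only [Function.update_self, Function.update_idem]
      rw [dif_pos h2]
      have : (⟨(x i : ℕ) - 1 + 1, h2⟩ : Fin (k i)) = x i := by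
        apply Fin.ext; simp only; omega
      rw [this, Function.update_eq_self]
    have v1 : (x i : ℕ) + 1 < k i → ((up i x i : Fin (k i)) : ℕ) = (x i : ℕ) + 1 := by
      intro h; unfold up; rw [dif_pos h]; simp
    have v2 : (((dn i x i : Fin (k i))) : ℕ) = (x i : ℕ) - 1 := by
      unfold dn; simp
    have A : ((k i : ℝ) - 1 - ((x i : ℕ) : ℝ)) * (((up i x i : Fin (k i)) : ℕ) * f (dn i (up i x)))
        = ((k i : ℝ) - 1 - ((x i : ℕ) : ℝ)) * (((x i : ℕ) + 1) * f x) := by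
      by_cases h : (x i : ℕ) + 1 < k i
      · rw [e1 h, v1 h]; push_cast; ring
      · rw [up_coef i x h]; ring
    have B : ((x i : ℕ) : ℝ) * (((k i : ℝ) - 1 - (((dn i x i : Fin (k i)) : ℕ) : ℝ)) *
        f (up i (dn i x))) = ((x i : ℕ) : ℝ) * (((k i : ℝ) - ((x i : ℕ) : ℝ)) * f x) := by
      by_cases h : (x i : ℕ) = 0
      · rw [h]; simp
      · rw [e2 h, v2, Nat.cast_sub (by omega)]; push_cast; ring
    rw [A, B]; ring
  · rw [if_neg hij, add_zero]
    have h1 : up i x j = x j := by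
      unfold up; rw [Function.update_of_ne (Ne.symm hij)]
    have h2 : dn j x i = x i := by
      unfold dn; rw [Function.update_of_ne hij]
    have h3 : dn j (up i x) = up i (dn j x) := by
      have : ∀ y : ∀ i, Fin (k i), dn j y = Function.update y j ⟨(y j : ℕ) - 1, by have := (y j).2; omega⟩ :=
        fun y => rfl
      have h4 : ∀ y : ∀ i, Fin (k i), up i y = Function.update y i
        (if h : (y i : ℕ) + 1 < k i then ⟨(y i : ℕ) + 1, h⟩ else y i) := fun y => rfl
      rw [this (up i x), h4 (dn j x)]
      simp only [h1, h2]
      exact Function.update_comm hij _ _ x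
    rw [h1, h2, h3]; ring

theorem comm {j : ℕ} {f : (∀ i, Fin (k i)) → ℝ} (hk : ∀ i, 1 ≤ k i) (hf : f ∈ lev k j) :
    L (U f) = U (L f) + (((∑ i, (k i - 1) : ℕ) : ℝ) - 2 * j) • f := by
  funext x
  have h1 : L (U f) x = ∑ i, ∑ j, ((k i : ℝ) - 1 - ((x i : ℕ) : ℝ)) *
      (((up i x j : Fin (k j)) : ℕ) * f (dn j (up i x))) := by
    simp only [L_apply, U_apply, Finset.mul_sum]
  have h2 : U (L f) x = ∑ i, ∑ j, ((x j : ℕ) : ℝ) *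
      (((k i : ℝ) - 1 - (((dn j x i : Fin (k i)) : ℕ) : ℝ)) * f (up i (dn j x))) := by
    rw [Finset.sum_comm]
    simp only [L_apply, U_apply, Finset.mul_sum]
  rw [h1, Pi.add_apply, h2]
  simp only [term_eq, Finset.sum_add_distrib, Finset.sum_ite_eq, Finset.mem_univ, if_true]
  congr 1
  rw [← Finset.sum_mul, Pi.smul_apply, smul_eq_mul]
  by_cases hx : wt x = j
  · congr 1
    rw [Finset.sum_sub_distrib, ← Finset.mul_sum, ← hx]
    unfold wt
    push_cast
    congr 1
    apply Finset.sum_congr rfl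
    intro i _
    rw [Nat.cast_sub (hk i)]; simp
  · rw [hf x hx]; simp

theorem Upow_mem {j : ℕ} {f : (∀ i, Fin (k i)) → ℝ} (hf : f ∈ lev k j) (m : ℕ) :
    (U ^ m) f ∈ lev k (j + m) := by
  induction m with
  | zero => simpa using hf
  | succ m ih => rw [pow_succ']; exact U_mem ih

theorem ladder {r : ℕ} {f : (∀ i, Fin (k i)) → ℝ} (hk : ∀ i, 1 ≤ k i) (hf : f ∈ lev k r)
    (hL : L f = 0) (m : ℕ) :
    L ((U ^ (m + 1)) f) =
      (((m : ℝ) + 1) * (((∑ i, (k i - 1) : ℕ) : ℝ) - 2 * r - m)) • (U ^ m) f := by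
  induction m with
  | zero =>
    simp only [zero_add, pow_one, pow_zero]
    rw [comm hk hf, hL]; simp
  | succ m ih =>
    rw [pow_succ', Module.End.mul_apply, comm hk (Upow_mem hf (m + 1)), ih, map_smul,
      ← Module.End.mul_apply, ← pow_succ', ← add_smul]
    congr 1
    push_cast
    ring

theorem prim_inj {r : ℕ} {f : (∀ i, Fin (k i)) → ℝ} (hk : ∀ i, 1 ≤ k i) (hf : f ∈ lev k r)
    (hL : L f = 0) (m : ℕ) (hm : ∀ i < m, (((∑ i, (k i - 1) : ℕ) : ℝ) - 2 * r - i) ≠ 0)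
    (h0 : (U ^ m) f = 0) : f = 0 := by
  induction m with
  | zero => simpa using h0
  | succ m ih =>
    apply ih (fun i hi => hm i (by omega))
    have h := ladder hk hf hL m
    rw [h0, map_zero] at h
    rcases smul_eq_zero.1 h.symm with h | h
    · rcases mul_eq_zero.1 h with h | h
      · exact absurd h (by positivity)
      · exact absurd h (hm m (by omega))
    · exact h

theorem lev_big {j : ℕ} (hj : ∑ i, (k i - 1) < j) {f : (∀ i, Fin (k i)) → ℝ}
    (hf : f ∈ lev k j) : f = 0 := by
  funext x
  apply hf
  have := wt_le x
  omega

theorem prim_top {r : ℕ} {f : (∀ i, Fin (k i)) → ℝ} (hk : ∀ i, 1 ≤ k i) (hf : f ∈ lev k r)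
    (hL : L f = 0) (hr : 2 * r ≤ ∑ i, (k i - 1)) (m : ℕ) (hm : ∑ i, (k i - 1) < 2 * r + m) :
    (U ^ m) f = 0 := by
  obtain ⟨q, hq⟩ : ∃ q, q + 2 * r = ∑ i, (k i - 1) := ⟨∑ i, (k i - 1) - 2 * r, by omega⟩
  have key : (U ^ (q + 1)) f = 0 := by
    have h1 := ladder hk hf hL q
    have h2 : (((∑ i, (k i - 1) : ℕ) : ℝ) - 2 * r - q) = 0 := by
      rw [← hq]; push_cast; ring
    rw [h2, mul_zero, zero_smul] at h1
    apply prim_inj hk (Upow_mem hf (q + 1)) h1 (r + 1)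
    · intro i _
      rw [← hq]
      push_cast
      have : (0 : ℝ) ≤ i := by positivity
      have : (0 : ℝ) ≤ q := by positivity
      apply ne_of_lt
      linarith
    · exact lev_big (j := r + (q + 1) + (r + 1)) (by omega) (Upow_mem (Upow_mem hf (q + 1)) (r + 1))
  obtain ⟨s, rfl⟩ : ∃ s, m = s + (q + 1) := ⟨m - (q + 1), by omega⟩
  rw [pow_add, Module.End.mul_apply, key, map_zero]

/-- binomial kernel -/
noncomputable def Cb (b a : ∀ i, Fin (k i)) : ℝ := ∏ i, ((b i : ℕ).choose (a i : ℕ) : ℝ)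

theorem Cb_dn (i : Fin n) (b a : ∀ i, Fin (k i)) :
    ((b i : ℕ) : ℝ) * Cb (dn i b) a = (((b i : ℕ) : ℝ) - ((a i : ℕ) : ℝ)) * Cb b a := by
  unfold Cb
  rw [← Finset.mul_prod_erase _ _ (Finset.mem_univ i),
    ← Finset.mul_prod_erase (a := i) Finset.univ (fun i => ((b i : ℕ).choose (a i : ℕ) : ℝ))
    (Finset.mem_univ i)]
  have : ∏ j ∈ Finset.univ.erase i, (((dn i b j : Fin (k j)) : ℕ).choose (a j : ℕ) : ℝ) =
      ∏ j ∈ Finset.univ.erase i, ((b j : ℕ).choose (a j : ℕ) : ℝ) := by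
    apply Finset.prod_congr rfl
    intro j hj
    unfold dn
    rw [Function.update_of_ne (Finset.ne_of_mem_erase hj)]
  rw [this, ← mul_assoc, ← mul_assoc]
  congr 1
  have v2 : (((dn i b i : Fin (k i))) : ℕ) = (b i : ℕ) - 1 := by
    unfold dn; simp
  rw [v2]
  generalize (b i : ℕ) = p
  generalize (a i : ℕ) = q
  rcases p with _ | p
  · rcases q with _ | q <;> simp
  · have h' := Nat.choose_mul_succ_eq p q
    simp only [Nat.add_sub_cancel]
    rcases le_or_gt q (p + 1) with hq | hq
    · have : ((p.choose q * (p + 1) : ℕ) : ℝ) = (((p + 1).choose q * (p + 1 - q) : ℕ) : ℝ) := by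
        exact_mod_cast h'
      rw [Nat.cast_mul, Nat.cast_mul, Nat.cast_sub hq] at this
      linarith
    · rw [Nat.choose_eq_zero_of_lt (show p < q by omega), Nat.choose_eq_zero_of_lt hq]; simp

theorem Cb_self (b : ∀ i, Fin (k i)) : Cb b b = 1 := by simp [Cb]

theorem Cb_ne {b a : ∀ i, Fin (k i)} (h : wt b ≤ wt a) (hne : a ≠ b) : Cb b a = 0 := by
  by_contra hc
  have hle : ∀ i, (a i : ℕ) ≤ (b i : ℕ) := by
    intro i
    by_contra hi
    apply hc
    apply Finset.prod_eq_zero (Finset.mem_univ i)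
    rw [Nat.choose_eq_zero_of_lt (by omega)]; simp
  apply hne
  have hs : wt a ≤ wt b := Finset.sum_le_sum (fun i _ => hle i)
  have := (Finset.sum_eq_sum_iff_of_le (fun i (_ : i ∈ Finset.univ) => hle i)).1 (le_antisymm hs h)
  funext i
  exact Fin.ext (this i (Finset.mem_univ i))

theorem expU {t : ℕ} {f : (∀ i, Fin (k i)) → ℝ} (hf : f ∈ lev k t) (m : ℕ)
    (b : ∀ i, Fin (k i)) (hb : wt b = t + m) :
    (U ^ m) f b = (m.factorial : ℝ) * ∑ a, Cb b a * f a := by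
  induction m generalizing b with
  | zero =>
    rw [Finset.sum_eq_single b]
    · simp [Cb_self]
    · intro a _ ha
      by_cases h : wt a = t
      · rw [Cb_ne (by omega) ha, zero_mul]
      · rw [hf a h, mul_zero]
    · simp
  | succ m ih =>
    rw [pow_succ', Module.End.mul_apply]
    change ∑ i, ((b i : ℕ) : ℝ) * ((U ^ m) f) (dn i b) = _
    have h1 : ∀ i, ((b i : ℕ) : ℝ) * ((U ^ m) f) (dn i b) =
        ∑ a, (m.factorial : ℝ) * ((((b i : ℕ) : ℝ) - ((a i : ℕ) : ℝ)) * (Cb b a * f a)) := by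
      intro i
      have h2 : ((b i : ℕ) : ℝ) * ((U ^ m) f) (dn i b) =
          ((b i : ℕ) : ℝ) * ((m.factorial : ℝ) * ∑ a, Cb (dn i b) a * f a) := by
        by_cases h : (b i : ℕ) = 0
        · simp [h]
        · rw [ih]
          have := wt_dn i b h
          omega
      rw [h2, Finset.mul_sum, Finset.mul_sum]
      apply Finset.sum_congr rfl
      intro a _
      have := Cb_dn i b a
      linear_combination (m.factorial : ℝ) * f a * this
    simp only [h1]
    rw [Finset.sum_comm, Finset.mul_sum]
    apply Finset.sum_congr rfl
    intro a _
    rw [← Finset.mul_sum, ← Finset.sum_mul, Finset.sum_sub_distrib]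
    by_cases h : wt a = t
    · have h3 : ∑ i, ((b i : ℕ) : ℝ) - ∑ i, ((a i : ℕ) : ℝ) = (m : ℝ) + 1 := by
        have e1 : ∑ i, ((b i : ℕ) : ℝ) = (wt b : ℝ) := by unfold wt; push_cast; rfl
        have e2 : ∑ i, ((a i : ℕ) : ℝ) = (wt a : ℝ) := by unfold wt; push_cast; rfl
        rw [e1, e2, hb, h]; push_cast; ring
      rw [h3, Nat.factorial_succ]; push_cast; ring
    · rw [hf a h]; simp

theorem expU_zero {t : ℕ} {f : (∀ i, Fin (k i)) → ℝ} (hf : f ∈ lev k t)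
    (b : ∀ i, Fin (k i)) (hb : wt b < t) : ∑ a, Cb b a * f a = 0 := by
  apply Finset.sum_eq_zero
  intro a _
  by_cases h : wt a = t
  · rw [Cb_ne (by omega), zero_mul]
    rintro rfl; omega
  · rw [hf a h, mul_zero]

/-- layer functions as functions on a subtype -/
noncomputable def levEquiv (k : Fin n → ℕ) (j : ℕ) :
    lev k j ≃ₗ[ℝ] ({x : ∀ i, Fin (k i) // ∑ i, (x i : ℕ) = j} → ℝ) where
  toFun f := fun x => f.1 x.1
  map_add' f g := rfl
  map_smul' c f := rfl
  invFun g := ⟨fun x => if h : ∑ i, (x i : ℕ) = j then g ⟨x, h⟩ else 0, by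
    intro x hx
    exact dif_neg hx⟩
  left_inv f := by
    apply Subtype.ext
    funext x
    dsimp only
    split_ifs with h
    · rfl
    · exact (f.2 x h).symm
  right_inv g := by
    funext x
    exact dif_pos x.2

theorem finrank_lev (k : Fin n → ℕ) (j : ℕ) : Module.finrank ℝ (lev k j) = layerCard n k j := by
  rw [(levEquiv k j).finrank_eq, Module.finrank_fintype_fun_eq_card, Fintype.card_subtype]
  rfl

/-- primitive vectors -/
def prim (k : Fin n → ℕ) (r : ℕ) : Submodule ℝ ((∀ i, Fin (k i)) → ℝ) :=
  lev k r ⊓ LinearMap.ker L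

theorem prim_zero (k : Fin n → ℕ) : layerCard n k 0 ≤ Module.finrank ℝ (prim k 0) := by
  rw [← finrank_lev]
  apply Submodule.finrank_mono
  intro f hf
  exact ⟨hf, L_zero hf⟩

theorem prim_succ (k : Fin n → ℕ) (r : ℕ) :
    layerCard n k (r + 1) ≤ Module.finrank ℝ (prim k (r + 1)) + layerCard n k r := by
  rw [← finrank_lev, ← finrank_lev]
  have h := LinearMap.finrank_range_add_finrank_ker ((L (k := k)).domRestrict (lev k (r + 1)))
  have h1 : Module.finrank ℝ (LinearMap.range ((L (k := k)).domRestrict (lev k (r + 1)))) ≤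
      Module.finrank ℝ (lev k r) := by
    apply Submodule.finrank_mono
    rintro _ ⟨f, rfl⟩
    exact L_mem f.2
  have h2 : Module.finrank ℝ (LinearMap.ker ((L (k := k)).domRestrict (lev k (r + 1)))) ≤
      Module.finrank ℝ (prim k (r + 1)) := by
    rw [← Submodule.finrank_map_subtype_eq]
    apply Submodule.finrank_mono
    rintro _ ⟨f, hf, rfl⟩
    exact ⟨f.2, hf⟩
  omega

theorem layer_symm (k : Fin n → ℕ) (hk : ∀ i, 1 ≤ k i) (j : ℕ) (hj : j ≤ ∑ i, (k i - 1)) :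
    layerCard n k (∑ i, (k i - 1) - j) = layerCard n k j := by
  have hw : ∀ x : ∀ i, Fin (k i), ∑ i, ((x i).rev : ℕ) + ∑ i, (x i : ℕ) = ∑ i, (k i - 1) := by
    intro x
    rw [← Finset.sum_add_distrib]
    apply Finset.sum_congr rfl
    intro i _
    rw [Fin.val_rev]
    have := (x i).2
    omega
  unfold layerCard
  refine Finset.card_bij' (fun x _ i => (x i).rev) (fun x _ i => (x i).rev) ?_ ?_ ?_ ?_
  · intro x hx
    simp only [Finset.mem_filter, Finset.mem_univ, true_and] at hx ⊢
    have := hw x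
    omega
  · intro x hx
    simp only [Finset.mem_filter, Finset.mem_univ, true_and] at hx ⊢
    have := hw x
    omega
  · intro x _; funext i; simp
  · intro x _; funext i; simp

/-- index of strings -/
abbrev Bi (k : Fin n → ℕ) (N : ℕ) : Type :=
  Σ r : Fin (N / 2 + 1), Fin (Module.finrank ℝ (prim k (r : ℕ)))

/-- index of string elements -/
abbrev Si (k : Fin n → ℕ) (N : ℕ) : Type :=
  Σ b : Bi k N, (Finset.Icc (b.1 : ℕ) (N - (b.1 : ℕ)) : Finset ℕ)

/-- primitive generator -/
noncomputable def pv (k : Fin n → ℕ) (N : ℕ) (b : Bi k N) : (∀ i, Fin (k i)) → ℝ :=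
  (Module.finBasis ℝ (prim k (b.1 : ℕ)) b.2 : (∀ i, Fin (k i)) → ℝ)

/-- string element -/
noncomputable def uv (k : Fin n → ℕ) (N : ℕ) (s : Si k N) : (∀ i, Fin (k i)) → ℝ :=
  (U ^ ((s.2 : ℕ) - (s.1.1 : ℕ))) (pv k N s.1)

theorem pv_mem (k : Fin n → ℕ) (N : ℕ) (b : Bi k N) : pv k N b ∈ lev k (b.1 : ℕ) :=
  (Module.finBasis ℝ (prim k (b.1 : ℕ)) b.2).2.1

theorem pv_L (k : Fin n → ℕ) (N : ℕ) (b : Bi k N) : L (pv k N b) = 0 :=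
  (Module.finBasis ℝ (prim k (b.1 : ℕ)) b.2).2.2

theorem uv_mem (k : Fin n → ℕ) (N : ℕ) (s : Si k N) : uv k N s ∈ lev k (s.2 : ℕ) := by
  have h := Upow_mem (pv_mem k N s.1) ((s.2 : ℕ) - (s.1.1 : ℕ))
  have h2 := (Finset.mem_Icc.1 s.2.2).1
  rwa [Nat.add_sub_cancel' h2] at h

theorem uv_li (k : Fin n → ℕ) (hk : ∀ i, 1 ≤ k i) (N : ℕ) (hN : N = ∑ i, (k i - 1)) :
    LinearIndependent ℝ (uv k N) := by
  rw [Fintype.linearIndependent_iff]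
  intro g hg
  -- level j
  have key : ∀ j : ℕ, ∀ h : Bi k N → ℝ,
      (∀ b, h b = if hj : j ∈ Finset.Icc (b.1 : ℕ) (N - (b.1 : ℕ)) then g ⟨b, j, hj⟩ else 0) →
      ∑ b, h b • (U ^ (j - (b.1 : ℕ))) (pv k N b) = 0 := by
    intro j h hh
    funext x
    simp only [Finset.sum_apply, Pi.smul_apply, Pi.zero_apply, smul_eq_mul]
    by_cases hx : wt x = j
    · have h1 := congrFun hg x
      simp only [Finset.sum_apply, Pi.smul_apply, Pi.zero_apply, smul_eq_mul] at h1
      rw [Fintype.sum_sigma] at h1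
      rw [← h1]
      apply Finset.sum_congr rfl
      intro b _
      rw [hh b]
      split_ifs with hj
      · rw [Finset.sum_eq_single ⟨j, hj⟩]
        · rfl
        · intro t _ ht
          rw [uv_mem k N ⟨b, t⟩ x, mul_zero]
          intro h3
          apply ht
          apply Subtype.ext
          rw [hx] at h3
          exact h3.symm
        · simp
      · rw [zero_mul, Finset.sum_eq_zero]
        intro t _
        rw [uv_mem k N ⟨b, t⟩ x, mul_zero]
        intro h3
        apply hj
        rw [hx] at h3
        rw [h3]
        exact t.2
    · apply Finset.sum_eq_zero
      intro b _
      rw [hh b]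
      split_ifs with hj
      · have := uv_mem k N ⟨b, j, hj⟩ x hx
        change _ * uv k N ⟨b, j, hj⟩ x = 0
        rw [this, mul_zero]
      · rw [zero_mul]
  have main : ∀ r : ℕ, ∀ b : Bi k N, (b.1 : ℕ) = r → ∀ t, g ⟨b, t⟩ = 0 := by
    intro r
    induction r using Nat.strong_induction_on with
    | _ r ih =>
    rintro ⟨r', i⟩ hr ⟨j, hj⟩
    dsimp only at hr
    let h : Bi k N → ℝ := fun b =>
      if hj : j ∈ Finset.Icc (b.1 : ℕ) (N - (b.1 : ℕ)) then g ⟨b, j, hj⟩ else 0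
    have h0 := key j h (fun b => rfl)
    have hj' := Finset.mem_Icc.1 hj
    dsimp only at hj'
    have h1 : (U ^ (N - r - j)) (∑ b, h b • (U ^ (j - (b.1 : ℕ))) (pv k N b)) = 0 := by
      rw [h0, map_zero]
    rw [map_sum, Fintype.sum_sigma, Finset.sum_eq_single r'] at h1
    · have h2 : (U ^ (N - 2 * r)) (∑ i, h ⟨r', i⟩ • pv k N ⟨r', i⟩) = 0 := by
        rw [← h1, map_sum]
        apply Finset.sum_congr rfl
        intro i _
        rw [map_smul, map_smul, ← Module.End.mul_apply, ← pow_add]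
        congr 3
        dsimp only
        omega
      have hm : ∑ i, h ⟨r', i⟩ • pv k N ⟨r', i⟩ ∈ lev k r :=
        Submodule.sum_mem _ (fun i _ => Submodule.smul_mem _ _ (hr ▸ pv_mem k N ⟨r', i⟩))
      have hl : L (∑ i, h ⟨r', i⟩ • pv k N ⟨r', i⟩) = 0 := by
        rw [map_sum]
        apply Finset.sum_eq_zero
        intro i _
        rw [map_smul, pv_L, smul_zero]
      have h3 := prim_inj hk hm hl (N - 2 * r) (by
        intro i hi
        rw [← hN]
        obtain ⟨q, hq⟩ : ∃ q, N = q + 2 * r + i + 1 := ⟨N - 2 * r - i - 1, by omega⟩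
        rw [hq]
        push_cast
        have : (0 : ℝ) ≤ q := by positivity
        apply ne_of_gt
        linarith) h2
      have h4 := Fintype.linearIndependent_iff.1
        (Module.finBasis ℝ (prim k (r' : ℕ))).linearIndependent (fun i => h ⟨r', i⟩) (by
          apply Subtype.ext
          refine Eq.trans ?_ h3
          simp [pv]) i
      have h5 : h ⟨r', i⟩ = g ⟨⟨r', i⟩, j, hj⟩ := dif_pos hj
      rw [← h5]; exact h4
    · intro s _ hs
      apply Finset.sum_eq_zero
      intro i' _
      by_cases hjs : j ∈ Finset.Icc (s : ℕ) (N - (s : ℕ))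
      · have hjs' := Finset.mem_Icc.1 hjs
        rcases lt_trichotomy (s : ℕ) r with hlt | heq | hgt
        · have : h ⟨s, i'⟩ = g ⟨⟨s, i'⟩, j, hjs⟩ := dif_pos hjs
          rw [this, ih s hlt ⟨s, i'⟩ rfl, zero_smul, map_zero]
        · exact absurd (Fin.ext (heq.trans hr.symm)) hs
        · rw [map_smul, ← Module.End.mul_apply, ← pow_add,
            prim_top hk (pv_mem k N ⟨s, i'⟩) (pv_L k N ⟨s, i'⟩), smul_zero]
          · have := s.2
            dsimp only; omega
          · dsimp only; omega
      · have : h ⟨s, i'⟩ = 0 := dif_neg hjs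
        rw [this, zero_smul, map_zero]
    · simp
  rintro ⟨b, t⟩
  exact main _ b rfl t

/-- number of strings through level j -/
noncomputable def cnt (k : Fin n → ℕ) (N j : ℕ) : ℕ :=
  (Finset.univ.filter (fun b : Bi k N => j ∈ Finset.Icc (b.1 : ℕ) (N - (b.1 : ℕ)))).card

theorem cum (k : Fin n → ℕ) (j : ℕ) :
    layerCard n k j ≤ ∑ r ∈ Finset.range (j + 1), Module.finrank ℝ (prim k r) := by
  induction j with
  | zero => simpa using prim_zero k
  | succ j ih =>
    rw [Finset.sum_range_succ]
    have := prim_succ k j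
    omega

theorem cnt_eq_sum (k : Fin n → ℕ) (N j l : ℕ) (hl : 2 * l ≤ N) (hjl : j = l ∨ j = N - l) :
    cnt k N j = ∑ r ∈ Finset.range (l + 1), Module.finrank ℝ (prim k r) := by
  unfold cnt
  rw [Finset.card_filter, Fintype.sum_sigma]
  have h1 : ∀ r : Fin (N / 2 + 1), ∑ i : Fin (Module.finrank ℝ (prim k (r : ℕ))),
      (if j ∈ Finset.Icc (r : ℕ) (N - (r : ℕ)) then 1 else 0) =
      (fun r : ℕ => if r ≤ l then Module.finrank ℝ (prim k r) else 0) r := by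
    intro r
    have := r.2
    have h : j ∈ Finset.Icc (r : ℕ) (N - (r : ℕ)) ↔ (r : ℕ) ≤ l := by
      rw [Finset.mem_Icc]; omega
    simp only [h]
    split_ifs <;> simp
  have h2 : ∑ r : Fin (N / 2 + 1), ∑ i : Fin (Module.finrank ℝ (prim k (r : ℕ))),
      (if j ∈ Finset.Icc (r : ℕ) (N - (r : ℕ)) then 1 else 0) =
      ∑ r ∈ Finset.range (N / 2 + 1), if r ≤ l then Module.finrank ℝ (prim k r) else 0 := by
    rw [Finset.sum_congr rfl (fun r _ => h1 r)]
    exact Fin.sum_univ_eq_sum_range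
      (fun r : ℕ => if r ≤ l then Module.finrank ℝ (prim k r) else 0) (N / 2 + 1)
  refine h2.trans ?_
  rw [← Finset.sum_filter]
  apply Finset.sum_congr _ (fun _ _ => rfl)
  ext r
  simp only [Finset.mem_filter, Finset.mem_range]
  omega

theorem cnt_ge (k : Fin n → ℕ) (hk : ∀ i, 1 ≤ k i) (N : ℕ) (hN : N = ∑ i, (k i - 1))
    (j : ℕ) (hj : j ≤ N) : layerCard n k j ≤ cnt k N j := by
  by_cases h : 2 * j ≤ N
  · rw [cnt_eq_sum k N j j h (Or.inl rfl)]
    exact cum k j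
  · rw [cnt_eq_sum k N j (N - j) (by omega) (Or.inr (by omega)), ← layer_symm k hk j (by omega),
      ← hN]
    exact cum k (N - j)

theorem card_S (k : Fin n → ℕ) (N : ℕ) :
    Fintype.card (Si k N) = ∑ j ∈ Finset.range (N + 1), cnt k N j := by
  rw [Fintype.card_sigma]
  unfold cnt
  simp only [Finset.card_filter]
  rw [Finset.sum_comm]
  apply Finset.sum_congr rfl
  intro b _
  rw [← Finset.card_filter, Fintype.card_coe]
  congr 1
  ext j
  simp only [Finset.mem_filter, Finset.mem_range, Finset.mem_Icc]
  omega

theorem card_G (k : Fin n → ℕ) (N : ℕ) (hN : N = ∑ i, (k i - 1)) :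
    Fintype.card (∀ i, Fin (k i)) = ∑ j ∈ Finset.range (N + 1), layerCard n k j := by
  unfold layerCard
  rw [← Finset.card_univ]
  apply Finset.card_eq_sum_card_fiberwise
  intro x _
  have : wt x ≤ ∑ i, (k i - 1) := wt_le x
  simp only [Finset.coe_range, Set.mem_Iio]
  unfold wt at this
  omega

theorem card_le (k : Fin n → ℕ) (hk : ∀ i, 1 ≤ k i) (N : ℕ) (hN : N = ∑ i, (k i - 1)) :
    Fintype.card (Si k N) ≤ Fintype.card (∀ i, Fin (k i)) := by
  have := (uv_li k hk N hN).fintype_card_le_finrank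
  rwa [Module.finrank_fintype_fun_eq_card] at this

theorem cnt_eq (k : Fin n → ℕ) (hk : ∀ i, 1 ≤ k i) (N : ℕ) (hN : N = ∑ i, (k i - 1))
    (j : ℕ) (hj : j ≤ N) : cnt k N j = layerCard n k j := by
  have h := card_le k hk N hN
  rw [card_S, card_G k N hN] at h
  have h2 : ∀ j ∈ Finset.range (N + 1), layerCard n k j ≤ cnt k N j := fun j hj =>
    cnt_ge k hk N hN j (by simpa [Nat.lt_succ_iff] using hj)
  have h3 := (Finset.sum_eq_sum_iff_of_le h2).1 (le_antisymm (Finset.sum_le_sum h2) h)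
  exact (h3 j (by simpa [Nat.lt_succ_iff] using hj)).symm

theorem card_eq (k : Fin n → ℕ) (hk : ∀ i, 1 ≤ k i) (N : ℕ) (hN : N = ∑ i, (k i - 1)) :
    Fintype.card (Si k N) = Module.finrank ℝ ((∀ i, Fin (k i)) → ℝ) := by
  rw [Module.finrank_fintype_fun_eq_card, card_S, card_G k N hN]
  apply Finset.sum_congr rfl
  intro j hj
  exact cnt_eq k hk N hN j (by simpa [Nat.lt_succ_iff] using hj)

/-- truncated exponential -/
noncomputable def T (k : Fin n → ℕ) (I E : Finset ℕ) : Matrix (∀ i, Fin (k i)) (∀ i, Fin (k i)) ℝ :=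
  fun b a => if wt b ∈ E ∧ wt a ∈ I then Cb b a else 0

theorem T_uv (k : Fin n → ℕ) (hk : ∀ i, 1 ≤ k i) (N : ℕ) (hN : N = ∑ i, (k i - 1))
    (I E : Finset ℕ) (b : Bi k N) (t : (Finset.Icc (b.1 : ℕ) (N - (b.1 : ℕ)) : Finset ℕ)) :
    Matrix.toLin' (T k I E) (uv k N ⟨b, t⟩) =
      ∑ v, strBlock I E (Finset.Icc (b.1 : ℕ) (N - (b.1 : ℕ))) v t • uv k N ⟨b, v⟩ := by
  obtain ⟨t, ht⟩ := t
  have ht' := Finset.mem_Icc.1 ht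
  have hb1 : 2 * (b.1 : ℕ) ≤ N := by have := b.1.2; omega
  have hum := uv_mem k N ⟨b, ⟨t, ht⟩⟩
  dsimp only at hum
  funext x
  rw [Matrix.toLin'_apply]
  simp only [Matrix.mulVec, dotProduct, Finset.sum_apply, Pi.smul_apply, smul_eq_mul]
  have hL : ∑ a, T k I E x a * uv k N ⟨b, ⟨t, ht⟩⟩ a =
      if wt x ∈ E ∧ t ∈ I then ∑ a, Cb x a * uv k N ⟨b, ⟨t, ht⟩⟩ a else 0 := by
    split_ifs with h
    · apply Finset.sum_congr rfl
      intro a _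
      by_cases ha : wt a = t
      · unfold T; rw [ha, if_pos h]
      · rw [hum a ha]; simp
    · apply Finset.sum_eq_zero
      intro a _
      by_cases ha : wt a = t
      · unfold T; rw [ha, if_neg h, zero_mul]
      · rw [hum a ha]; simp
  refine hL.trans ?_
  symm
  by_cases hx : wt x ∈ Finset.Icc (b.1 : ℕ) (N - (b.1 : ℕ))
  · rw [Finset.sum_eq_single (⟨wt x, hx⟩ : (Finset.Icc (b.1 : ℕ) (N - (b.1 : ℕ)) : Finset ℕ))]
    · unfold strBlock
      dsimp only
      by_cases h : wt x ∈ E ∧ t ∈ I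
      · rw [if_pos h]
        symm
        by_cases hle : t ≤ wt x
        · rw [if_pos ⟨h.1, h.2, hle⟩]
          have e := expU hum (wt x - t) x (by omega)
          have e2 : (U ^ (wt x - t)) (uv k N ⟨b, ⟨t, ht⟩⟩) = uv k N ⟨b, ⟨wt x, hx⟩⟩ := by
            unfold uv
            rw [← Module.End.mul_apply, ← pow_add]
            congr 2
            dsimp only
            omega
          rw [e2] at e
          rw [e]
          have := Nat.factorial_ne_zero (wt x - t)
          field_simp
        · rw [if_neg (by tauto), zero_mul, expU_zero hum x (by omega)]
      · rw [if_neg (by tauto), if_neg h, zero_mul]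
    · intro v _ hv
      rw [uv_mem k N ⟨b, v⟩ x, mul_zero]
      intro h
      exact hv (Subtype.ext h.symm)
    · simp
  · rw [Finset.sum_eq_zero]
    · split_ifs with h
      · symm
        by_cases hle : t ≤ wt x
        · have e := expU hum (wt x - t) x (by omega)
          have e2 : (U ^ (wt x - t)) (uv k N ⟨b, ⟨t, ht⟩⟩) = 0 := by
            unfold uv
            rw [← Module.End.mul_apply, ← pow_add]
            apply prim_top hk (pv_mem k N b) (pv_L k N b)
            · omega
            · rw [Finset.mem_Icc] at hx
              dsimp only
              omega
          rw [e2] at e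
          have := Nat.factorial_ne_zero (wt x - t)
          have e3 := e.symm
          rw [Pi.zero_apply, mul_eq_zero] at e3
          rcases e3 with e3 | e3
          · exact absurd e3 (by exact_mod_cast this)
          · exact e3
        · exact expU_zero hum x (by omega)
      · rfl
    · intro v _
      rw [uv_mem k N ⟨b, v⟩ x, mul_zero]
      intro h
      exact hx (h ▸ v.2)

theorem rank_T (k : Fin n → ℕ) (hk : ∀ i, 1 ≤ k i) (N : ℕ) (hN : N = ∑ i, (k i - 1))
    (I E : Finset ℕ) : (T k I E).rank =
      ∑ b : Bi k N, (strBlock I E (Finset.Icc (b.1 : ℕ) (N - (b.1 : ℕ)))).rank := by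
  by_cases hne : Nonempty (Si k N)
  swap
  · exfalso
    apply hne
    rw [← Fintype.card_pos_iff, card_eq k hk N hN, Module.finrank_fintype_fun_eq_card]
    exact Fintype.card_pos_iff.2 ⟨fun i => ⟨0, hk i⟩⟩
  let v := basisOfLinearIndependentOfCardEqFinrank (uv_li k hk N hN) (card_eq k hk N hN)
  have hv : ∀ s, v s = uv k N s := fun s => by
    simp [v]
  rw [← aux_rank_blockDiagonal,
    Matrix.rank_eq_finrank_range_toLin (T k I E) (Pi.basisFun ℝ _) (Pi.basisFun ℝ _),
    Matrix.rank_eq_finrank_range_toLin _ v v, Matrix.toLin_eq_toLin']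
  have hmain : Matrix.toLin' (T k I E) = Matrix.toLin v v
      (Matrix.blockDiagonal' fun b : Bi k N =>
        strBlock I E (Finset.Icc (b.1 : ℕ) (N - (b.1 : ℕ)))) := ?_
  · rw [hmain]
  apply v.ext
  rintro ⟨b, t⟩
  rw [Matrix.toLin_self, hv, T_uv k hk N hN, Fintype.sum_sigma, Finset.sum_eq_single b]
  · apply Finset.sum_congr rfl
    intro x _
    rw [Matrix.blockDiagonal'_apply_eq, hv]
  · intro b' _ hb'
    apply Finset.sum_eq_zero
    intro x _
    rw [Matrix.blockDiagonal'_apply_ne _ _ _ hb', zero_smul]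
  · simp

end Gd


theorem aux_prod_sub (a b : ℕ) :
    ∏ t ∈ Finset.range a, ((b : ℝ) - (t : ℝ)) = (a.factorial : ℝ) * (b.choose a : ℝ) := by
  rw [← Nat.cast_mul, ← Nat.descFactorial_eq_factorial_mul_choose]
  induction a with
  | zero => simp
  | succ a ih =>
    rw [Finset.prod_range_succ, ih, Nat.descFactorial_succ]
    by_cases h : a ≤ b
    · push_cast [h]; ring
    · have : b.descFactorial a = 0 := Nat.descFactorial_eq_zero_iff_lt.2 (by omega)
      simp [this]

theorem aux_Ev (n : ℕ) (k : Fin n → ℕ) (I E : Finset ℕ) :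
    (EvMat n k I E).rank = (Gd.T k I E).rank := by
  rw [← aux_rank_pad (Gd.T k I E) (fun b => Gd.wt b ∈ E) (fun a => Gd.wt a ∈ I)
    (fun i j h => if_neg h)]
  have h : EvMat n k I E = Matrix.diagonal
      (fun α : {α : ∀ i, Fin (k i) // (∑ i, (α i : ℕ)) ∈ I} =>
        ∏ i, (((α.1 i : ℕ).factorial : ℕ) : ℝ)) *
      ((Gd.T k I E).submatrix (Subtype.val : {b : ∀ i, Fin (k i) // (∑ i, (b i : ℕ)) ∈ E} → _)
        (Subtype.val : {a : ∀ i, Fin (k i) // (∑ i, (a i : ℕ)) ∈ I} → _)).transpose := by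
    ext α β
    rw [Matrix.diagonal_mul, Matrix.transpose_apply, Matrix.submatrix_apply]
    have hT : Gd.T k I E β.1 α.1 = Gd.Cb β.1 α.1 := if_pos ⟨β.2, α.2⟩
    rw [hT]
    unfold EvMat Gd.Cb
    simp only [aux_prod_sub]
    rw [Finset.prod_mul_distrib]
    try push_cast
    try rfl
  rw [h]
  refine Eq.trans ?_ (Matrix.rank_transpose _)
  apply Matrix.rank_mul_eq_right_of_isUnit_det
  rw [Matrix.det_diagonal, isUnit_iff_ne_zero]
  apply Finset.prod_ne_zero_iff.2
  intro α _
  apply Finset.prod_ne_zero_iff.2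
  intro i _
  exact_mod_cast Nat.factorial_ne_zero _

theorem aux_min {n : ℕ} (k : Fin n → ℕ) (N s t : ℕ) (hs : s ≤ N) (ht : t ≤ N) :
    (Finset.univ.filter (fun b : Gd.Bi k N => s ∈ Finset.Icc (b.1 : ℕ) (N - (b.1 : ℕ)) ∧
      t ∈ Finset.Icc (b.1 : ℕ) (N - (b.1 : ℕ)))).card = min (Gd.cnt k N s) (Gd.cnt k N t) := by
  have hor : (∀ r : ℕ, r ≤ N / 2 → s ∈ Finset.Icc r (N - r) → t ∈ Finset.Icc r (N - r)) ∨
      (∀ r : ℕ, r ≤ N / 2 → t ∈ Finset.Icc r (N - r) → s ∈ Finset.Icc r (N - r)) := by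
    simp only [Finset.mem_Icc]
    by_cases h : min s (N - s) ≤ min t (N - t)
    · left; intro r hr h; omega
    · right; intro r hr h; omega
  unfold Gd.cnt
  rcases hor with h | h
  · rw [min_eq_left]
    · congr 1
      ext b
      have := h b.1 (by have := b.1.2; omega)
      simp only [Finset.mem_filter, Finset.mem_univ, true_and]
      tauto
    · apply Finset.card_le_card
      intro b
      have := h b.1 (by have := b.1.2; omega)
      simp only [Finset.mem_filter, Finset.mem_univ, true_and]
      tauto
  · rw [min_eq_right]
    · congr 1
      ext b
      have := h b.1 (by have := b.1.2; omega)
      simp only [Finset.mem_filter, Finset.mem_univ, true_and]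
      tauto
    · apply Finset.card_le_card
      intro b
      have := h b.1 (by have := b.1.2; omega)
      simp only [Finset.mem_filter, Finset.mem_univ, true_and]
      tauto

/-- For an interval `I = [c,d] ⊆ [0,N]` and an `I`-compatible set `E = {w_t : t ∈ I}`,
`rank(Ev_{I,E}) = ∑_{t ∈ I} min{[G choose t], [G choose w_t]}`. -/
theorem stmt_12 (n : ℕ) (k : Fin n → ℕ) (hk : ∀ i, 2 ≤ k i)
    (N : ℕ) (hN : N = ∑ i, (k i - 1)) (c d : ℕ) (hcd : c ≤ d) (hdN : d ≤ N)
    (w : ℕ → ℕ)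
    (hwN : ∀ t ∈ Finset.Icc c d, w t ≤ N)
    (hdistinct : Set.InjOn w (Finset.Icc c d))
    (hge : ∀ t ∈ Finset.Icc c d, t ≤ w t)
    (hbig : ∀ t ∈ Finset.Icc c d, w t ≠ t → d < w t)
    (hdec : ∀ s ∈ Finset.Icc c d, ∀ t ∈ Finset.Icc c d, s < t →
      w s ∉ Finset.Icc c d → w t ∉ Finset.Icc c d → w t < w s) :
    (EvMat n k (Finset.Icc c d) ((Finset.Icc c d).image w)).rank =
      ∑ t ∈ Finset.Icc c d, min (layerCard n k t) (layerCard n k (w t)) := by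
  have hk1 : ∀ i, 1 ≤ k i := fun i => by have := hk i; omega
  rw [aux_Ev, Gd.rank_T k hk1 N hN,
    Finset.sum_congr rfl (fun b _ => aux_str_rank c d N (b.1 : ℕ) w hdistinct hge hbig hdec)]
  simp only [Finset.card_filter]
  rw [Finset.sum_comm]
  apply Finset.sum_congr rfl
  intro t ht
  have htN : t ≤ N := by have := (Finset.mem_Icc.1 ht).2; omega
  rw [← Finset.card_filter, aux_min k N t (w t) htN (hwN t ht), Gd.cnt_eq k hk1 N hN t htN,
    Gd.cnt_eq k hk1 N hN (w t) (hwN t ht)]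
end

section
/- Let G be a uniform grid, I = [c,d] ⊆ [0,N] an interval, and E = {w_t : t ∈ I} an I-compatible set. Then the affine Hilbert function satisfies H_d(E̲) = Σ_{t∈I} min{[G choose t], [G choose w_t]}. -/
open scoped Classical

/-- Evaluation of polynomials as functions on a set `A ⊆ ℝⁿ`, as a linear map. -/
noncomputable def evalLM (n : ℕ) (A : Set (Fin n → ℝ)) :
    MvPolynomial (Fin n) ℝ →ₗ[ℝ] (A → ℝ) where
  toFun p := fun x => MvPolynomial.eval (x : Fin n → ℝ) p
  map_add' p q := by funext x; simp
  map_smul' c p := by funext x; simp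

/-- The affine Hilbert function `H_d(A)`. -/
noncomputable def hilbertFn (n : ℕ) (A : Set (Fin n → ℝ)) (d : ℕ) : ℕ :=
  Module.finrank ℝ
    ((MvPolynomial.restrictTotalDegree (Fin n) ℝ d).map (evalLM n A))

/-- The uniform grid `[0,k₁-1] × ⋯ × [0,kₙ-1]`, as a subset of `ℝⁿ`. -/
def gridSetR (n : ℕ) (k : Fin n → ℕ) : Set (Fin n → ℝ) :=
  {x | ∀ i, ∃ a : ℕ, a < k i ∧ x i = a}

/-- The weight-determined set `E̲ = {x ∈ G : wt(x) ∈ E}`, as a subset of `ℝⁿ`. -/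
def underlineR (n : ℕ) (k : Fin n → ℕ) (E : Set ℕ) : Set (Fin n → ℝ) :=
  {x | x ∈ gridSetR n k ∧ ∃ e ∈ E, ∑ i, x i = (e : ℝ)}

namespace HF

abbrev Gd {n : ℕ} (k : Fin n → ℕ) := ∀ i, Fin (k i)

variable {n : ℕ} {k : Fin n → ℕ}

def wt (x : Gd k) : ℕ := ∑ i, (x i : ℕ)

def dn (i : Fin n) (x : Gd k) : Gd k :=
  Function.update x i ⟨(x i).1 - 1, lt_of_le_of_lt (Nat.sub_le _ _) (x i).2⟩

def up (i : Fin n) (x : Gd k) : Gd k :=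
  if h : (x i).1 + 1 < k i then Function.update x i ⟨(x i).1 + 1, h⟩ else x

lemma dn_same (i : Fin n) (x : Gd k) : ((dn i x i : Fin (k i)) : ℕ) = (x i : ℕ) - 1 := by
  simp [dn]

lemma dn_ne {i j : Fin n} (h : j ≠ i) (x : Gd k) : dn i x j = x j := by
  simp [dn, h]

lemma up_same {i : Fin n} {x : Gd k} (h : (x i).1 + 1 < k i) :
    ((up i x i : Fin (k i)) : ℕ) = (x i : ℕ) + 1 := by
  simp [up, h]

lemma up_ne {i j : Fin n} (h : j ≠ i) (x : Gd k) : up i x j = x j := by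
  unfold up; split_ifs <;> simp [h]

lemma dn_up {i : Fin n} {x : Gd k} (h : (x i).1 + 1 < k i) : dn i (up i x) = x := by
  funext j
  by_cases hj : j = i
  · subst hj; apply Fin.ext; rw [dn_same, up_same h]; simp
  · rw [dn_ne hj, up_ne hj]

lemma up_dn {i : Fin n} {x : Gd k} (h : (x i).1 ≠ 0) : up i (dn i x) = x := by
  have h1 : (dn i x i).1 + 1 < k i := by rw [dn_same]; have := (x i).2; omega
  funext j
  by_cases hj : j = i
  · subst hj; apply Fin.ext; rw [up_same h1, dn_same]; omega
  · rw [up_ne hj, dn_ne hj]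

lemma dn_up_ne {i j : Fin n} (h : i ≠ j) (x : Gd k) : dn j (up i x) = up i (dn j x) := by
  have e : ((dn j x) i) = x i := dn_ne h x
  by_cases h1 : (x i).1 + 1 < k i
  · have h2 : ((dn j x) i).1 + 1 < k i := by rw [e]; exact h1
    funext l
    apply Fin.ext
    by_cases hi : l = i
    · subst hi; rw [dn_ne h, up_same h1, up_same h2, e]
    · rw [up_ne hi]
      by_cases hj : l = j
      · subst hj; rw [dn_same, dn_same, up_ne hi]
      · rw [dn_ne hj, dn_ne hj, up_ne hi]
  · have h2 : ¬ ((dn j x) i).1 + 1 < k i := by rw [e]; exact h1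
    simp only [up, dif_neg h1, dif_neg h2]

lemma wt_up {i : Fin n} {x : Gd k} (h : (x i).1 + 1 < k i) : wt (up i x) = wt x + 1 := by
  unfold wt
  rw [← Finset.add_sum_erase _ _ (Finset.mem_univ i),
    ← Finset.add_sum_erase (f := fun j => (x j : ℕ)) _ (Finset.mem_univ i), up_same h]
  rw [Finset.sum_congr rfl (g := fun j => (x j : ℕ))
    (fun j hj => by rw [up_ne (Finset.ne_of_mem_erase hj)])]
  ring

lemma wt_dn {i : Fin n} {x : Gd k} (h : (x i).1 ≠ 0) : wt (dn i x) + 1 = wt x := by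
  have h1 : (dn i x i).1 + 1 < k i := by rw [dn_same]; have := (x i).2; omega
  rw [← wt_up h1, up_dn h]

noncomputable def U : (Gd k → ℝ) →ₗ[ℝ] (Gd k → ℝ) where
  toFun g := fun x => ∑ i, ((x i : ℕ) : ℝ) * g (dn i x)
  map_add' g h := by funext x; simp [mul_add, Finset.sum_add_distrib]
  map_smul' c g := by
    funext x; simp [Finset.mul_sum]; exact Finset.sum_congr rfl fun i _ => by ring

noncomputable def D : (Gd k → ℝ) →ₗ[ℝ] (Gd k → ℝ) where
  toFun g := fun x => ∑ i, ((k i : ℝ) - 1 - ((x i : ℕ) : ℝ)) * g (up i x)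
  map_add' g h := by funext x; simp [mul_add, Finset.sum_add_distrib]
  map_smul' c g := by
    funext x; simp [Finset.mul_sum]; exact Finset.sum_congr rfl fun i _ => by ring

lemma U_apply (g : Gd k → ℝ) (x : Gd k) :
    U g x = ∑ i, ((x i : ℕ) : ℝ) * g (dn i x) := rfl
lemma D_apply (g : Gd k → ℝ) (x : Gd k) :
    D g x = ∑ i, ((k i : ℝ) - 1 - ((x i : ℕ) : ℝ)) * g (up i x) := rfl

lemma comm (g : Gd k → ℝ) (x : Gd k) :
    D (U g) x = U (D g) x + ((∑ i, ((k i : ℝ) - 1)) - 2 * (wt x : ℝ)) * g x := by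
  simp only [U_apply, D_apply, Finset.mul_sum]
  rw [Finset.sum_comm (f := fun i j => ((x i : ℕ) : ℝ) * _)]
  have h2 : ((∑ i, ((k i : ℝ) - 1)) - 2 * (wt x : ℝ)) * g x
      = ∑ i : Fin n, ∑ j : Fin n, if j = i then ((k i : ℝ) - 1 - 2 * ((x i : ℕ) : ℝ)) * g x else 0 := by
    simp only [Finset.sum_ite_eq', Finset.mem_univ, if_true]
    rw [← Finset.sum_mul, Finset.sum_sub_distrib (fun i => (k i : ℝ) - 1), ← Finset.mul_sum]
    simp [wt]
  rw [h2, ← Finset.sum_add_distrib]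
  refine Finset.sum_congr rfl fun i _ => ?_
  rw [← Finset.sum_add_distrib]
  refine Finset.sum_congr rfl fun j _ => ?_
  by_cases hj : j = i
  · subst hj
    rw [if_pos rfl]
    have hlt := (x j).2
    have a1 : ((k j : ℝ) - 1 - ((x j : ℕ) : ℝ)) * ((((up j x) j : Fin (k j)) : ℕ) * g (dn j (up j x)))
        = ((k j : ℝ) - 1 - ((x j : ℕ) : ℝ)) * ((((x j : ℕ) : ℝ) + 1) * g x) := by
      by_cases h : (x j).1 + 1 < k j
      · rw [dn_up h, up_same h]; push_cast; ring
      · have : k j = (x j).1 + 1 := by omega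
        have : (k j : ℝ) = (x j : ℕ) + 1 := by exact_mod_cast this
        rw [this]; ring
    have a2 : ((x j : ℕ) : ℝ) * (((k j : ℝ) - 1 - (((dn j x) j : Fin (k j)) : ℕ)) * g (up j (dn j x)))
        = ((x j : ℕ) : ℝ) * (((k j : ℝ) - ((x j : ℕ) : ℝ)) * g x) := by
      by_cases h : (x j).1 = 0
      · rw [h]; simp
      · rw [up_dn h, dn_same, Nat.cast_sub (by omega)]; push_cast; ring
    rw [a1, a2]; ring
  · rw [if_neg hj, up_ne hj, dn_ne (Ne.symm hj), dn_up_ne (Ne.symm hj)]; ring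

/-- functions supported on the layer `t`. -/
def lay (t : ℕ) : Submodule ℝ (Gd k → ℝ) where
  carrier := {g | ∀ x, wt x ≠ t → g x = 0}
  add_mem' := by intro a b ha hb x hx; simp [ha x hx, hb x hx]
  zero_mem' := by intro x _; rfl
  smul_mem' := by intro c a ha x hx; simp [ha x hx]

lemma mem_lay {t : ℕ} {g : Gd k → ℝ} : g ∈ lay t ↔ ∀ x, wt x ≠ t → g x = 0 := Iff.rfl

lemma U_mem {t : ℕ} {g : Gd k → ℝ} (hg : g ∈ lay t) : U g ∈ lay (t+1) := by
  intro x hx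
  rw [U_apply]
  refine Finset.sum_eq_zero fun i _ => ?_
  by_cases h : (x i).1 = 0
  · rw [h]; simp
  · rw [hg _ (by have := wt_dn h; omega), mul_zero]

lemma Upow_mem {t : ℕ} {g : Gd k → ℝ} (hg : g ∈ lay t) (m : ℕ) : (U ^ m) g ∈ lay (t+m) := by
  induction m with
  | zero => simpa using hg
  | succ m ih => rw [pow_succ', Module.End.mul_apply, ← add_assoc]; exact U_mem ih

lemma D_zero {t : ℕ} {g : Gd k → ℝ} (hg : g ∈ lay t) (x : Gd k) (hx : wt x + 1 ≠ t) :
    D g x = 0 := by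
  rw [D_apply]
  refine Finset.sum_eq_zero fun i _ => ?_
  by_cases h : (x i).1 + 1 < k i
  · rw [hg _ (by rw [wt_up h]; exact hx), mul_zero]
  · have := (x i).2
    have : k i = (x i).1 + 1 := by omega
    have : (k i : ℝ) = (x i : ℕ) + 1 := by exact_mod_cast this
    rw [this]; ring

lemma D_mem {t : ℕ} {g : Gd k → ℝ} (hg : g ∈ lay (t+1)) : D g ∈ lay t :=
  fun x hx => D_zero hg x (by omega)

lemma comm_lay {t : ℕ} {g : Gd k → ℝ} (hg : g ∈ lay t) :
    D (U g) = U (D g) + ((∑ i, ((k i : ℝ) - 1)) - 2 * (t : ℝ)) • g := by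
  funext x
  rw [comm, Pi.add_apply, Pi.smul_apply, smul_eq_mul]
  by_cases h : wt x = t
  · rw [h]
  · rw [hg x h]; simp

lemma comm_pow {t : ℕ} {g : Gd k → ℝ} (hg : g ∈ lay t) (m : ℕ) :
    D ((U ^ (m+1)) g) = (U ^ (m+1)) (D g) +
      (((m : ℝ) + 1) * ((∑ i, ((k i : ℝ) - 1)) - 2 * (t : ℝ) - m)) • (U ^ m) g := by
  induction m with
  | zero => simp [comm_lay hg]
  | succ m ih =>
    rw [pow_succ' U (m+1), Module.End.mul_apply, comm_lay (Upow_mem hg (m+1)), ih, map_add,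
      map_smul, Module.End.mul_apply, ← Module.End.mul_apply U (U^m), ← pow_succ', add_assoc,
      ← add_smul]
    congr 2
    push_cast; ring

lemma inj {N : ℕ} (hN : (N : ℝ) = ∑ i, ((k i : ℝ) - 1)) (t : ℕ) : ∀ (m : ℕ) (g : Gd k → ℝ),
    g ∈ lay t → 2 * t + m ≤ N → (U ^ m) g = 0 → g = 0 := by
  have main : ∀ (t m : ℕ) (g : Gd k → ℝ), g ∈ lay t → 2 * t + m ≤ N → D g = 0 →
      (U ^ m) g = 0 → g = 0 := by
    intro t m g hg h hD hU
    induction m with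
    | zero => simpa using hU
    | succ m ih =>
      apply ih (by omega)
      have := comm_pow hg m
      rw [hU, hD, map_zero, map_zero, zero_add] at this
      rcases smul_eq_zero.1 this.symm with h0 | h0
      · exfalso
        rw [← hN] at h0
        have h1 : (2 * t + (m+1) : ℝ) ≤ N := by exact_mod_cast h
        have : (0:ℝ) ≤ m := by positivity
        have : 0 < ((m : ℝ) + 1) * ((N:ℝ) - 2 * (t : ℝ) - m) :=
          mul_pos (by linarith) (by linarith)
        linarith
      · exact h0
  induction t with
  | zero =>
    intro m g hg h hU
    refine main 0 m g hg h ?_ hU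
    funext x; exact D_zero hg x (by omega)
  | succ t ih =>
    intro m g hg h hU
    refine main _ m g hg h ?_ hU
    refine ih (m+1) _ (D_mem hg) (by omega) ?_
    have := comm_pow hg m
    rw [hU, smul_zero, add_zero, pow_succ', Module.End.mul_apply, hU, map_zero, map_zero] at this
    rw [pow_succ', Module.End.mul_apply]
    exact this.symm

lemma finrank_lay (t : ℕ) : Module.finrank ℝ (lay (k := k) t) = layerCard n k t := by
  let e : (lay (k := k) t) ≃ₗ[ℝ] ({x : Gd k // wt x = t} → ℝ) :=
    { toFun := fun g x => g.1 x.1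
      map_add' := fun _ _ => rfl
      map_smul' := fun _ _ => rfl
      invFun := fun h => ⟨fun x => if hx : wt x = t then h ⟨x, hx⟩ else 0, by
        intro x hx; simp [hx]⟩
      left_inv := by
        intro g; apply Subtype.ext; funext x
        by_cases hx : wt x = t
        · simp [hx]
        · simp [hx, g.2 x hx]
      right_inv := by
        intro h; funext x; simp [x.2] }
  rw [e.finrank_eq, Module.finrank_fintype_fun_eq_card, Fintype.card_subtype]
  unfold layerCard wt
  congr

lemma layerCard_symm {N : ℕ} (hN : N = ∑ i, (k i - 1)) {t : ℕ} (ht : t ≤ N) :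
    layerCard n k t = layerCard n k (N - t) := by
  have key : ∀ x : Gd k, (∑ i, ((x i).rev : ℕ)) + ∑ i, (x i : ℕ) = N := by
    intro x
    rw [hN, ← Finset.sum_add_distrib]
    refine Finset.sum_congr rfl fun i _ => ?_
    rw [Fin.val_rev]; have := (x i).2; omega
  unfold layerCard
  refine Finset.card_nbij' (fun (x : Gd k) i => (x i).rev) (fun (x : Gd k) i => (x i).rev) ?_ ?_ ?_ ?_
  · intro x hx
    simp only [Finset.coe_filter, Finset.mem_univ, true_and, Set.mem_ofPred_eq] at hx ⊢
    have := key x; omega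
  · intro x hx
    simp only [Finset.coe_filter, Finset.mem_univ, true_and, Set.mem_ofPred_eq] at hx ⊢
    have := key x; omega
  · intro x _; simp
  · intro x _; simp

lemma finrank_map_congr {M M₁ M₂ : Type*} [AddCommGroup M] [Module ℝ M] [FiniteDimensional ℝ M]
    [AddCommGroup M₁] [Module ℝ M₁] [AddCommGroup M₂] [Module ℝ M₂] (V : Submodule ℝ M)
    (f : M →ₗ[ℝ] M₁) (g : M →ₗ[ℝ] M₂) (h : ∀ x ∈ V, f x = 0 ↔ g x = 0) :
    Module.finrank ℝ (V.map f) = Module.finrank ℝ (V.map g) := by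
  have h1 := LinearMap.finrank_range_add_finrank_ker (f.domRestrict V)
  have h2 := LinearMap.finrank_range_add_finrank_ker (g.domRestrict V)
  have h3 : LinearMap.ker (f.domRestrict V) = LinearMap.ker (g.domRestrict V) := by
    ext x; simpa using h x.1 x.2
  rw [LinearMap.range_domRestrict] at h1 h2
  rw [h3] at h1
  omega

lemma rank_U {N : ℕ} (hk : ∀ i, 1 ≤ k i) (hN : N = ∑ i, (k i - 1)) {t v : ℕ} (htv : t ≤ v)
    (hv : v ≤ N) : Module.finrank ℝ ((lay (k := k) t).map (U ^ (v - t))) =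
      min (layerCard n k t) (layerCard n k v) := by
  have hN' : (N : ℝ) = ∑ i, ((k i : ℝ) - 1) := by
    rw [hN]; push_cast
    exact Finset.sum_congr rfl fun i _ => by rw [Nat.cast_sub (hk i)]; simp
  have hle : ∀ s, s ≤ v → (lay (k := k) s).map (U ^ (v - s)) ≤ lay v := by
    rintro s hs _ ⟨g, hg, rfl⟩
    have := Upow_mem hg (v - s)
    rwa [Nat.add_sub_cancel' hs] at this
  have hinj : ∀ s, s ≤ v → s + v ≤ N →
      Module.finrank ℝ ((lay (k := k) s).map (U ^ (v - s))) = layerCard n k s := by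
    intro s hs hsv
    rw [← finrank_lay, finrank_map_congr _ _ (LinearMap.id) (fun g hg => ⟨fun h => ?_, fun h => ?_⟩),
      Submodule.map_id]
    · exact inj hN' s (v - s) g hg (by omega) h
    · rw [show g = 0 from h, map_zero]
  have h2 := Submodule.finrank_mono (hle t htv)
  have h3 := Submodule.finrank_map_le (U ^ (v - t)) (lay (k := k) t)
  rw [finrank_lay] at h2 h3
  by_cases h : t + v ≤ N
  · have := hinj t htv h
    omega
  · have h1 := hinj (N - v) (by omega) (by omega)
    rw [← layerCard_symm hN hv] at h1
    have h4 : (lay (k := k) (N - v)).map (U ^ (v - (N - v))) ≤ (lay t).map (U ^ (v - t)) := by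
      rintro _ ⟨g, hg, rfl⟩
      refine ⟨(U ^ (t - (N - v))) g, ?_, ?_⟩
      · have := Upow_mem hg (t - (N - v))
        rwa [Nat.add_sub_cancel' (by omega)] at this
      · rw [← Module.End.mul_apply, ← pow_add]; congr 2; omega
    have := Submodule.finrank_mono h4
    omega

/-- product of binomials. -/
noncomputable def b (a x : Gd k) : ℝ := ∏ i, ((Nat.choose (x i) (a i) : ℕ) : ℝ)

lemma b_zero {a x : Gd k} (i : Fin n) (h : (x i).1 < (a i).1) : b a x = 0 := by
  unfold b
  exact Finset.prod_eq_zero (Finset.mem_univ i) (by simp [Nat.choose_eq_zero_of_lt h])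

lemma b_wt {a x : Gd k} (h : wt x ≤ wt a) (hne : x ≠ a) : b a x = 0 := by
  by_contra hb
  have h1 : ∀ i, (a i).1 ≤ (x i).1 := by
    intro i; by_contra hi; exact hb (b_zero i (by omega))
  have h2 : wt x = wt a := le_antisymm h (Finset.sum_le_sum fun i _ => h1 i)
  have h3 := (Finset.sum_eq_sum_iff_of_le (fun i (_ : i ∈ Finset.univ) => h1 i)).1 h2.symm
  exact hne (funext fun i => Fin.ext (h3 i (Finset.mem_univ i)).symm)

lemma b_self (a : Gd k) : b a a = 1 := by simp [b]

lemma b_mul (a x : Gd k) (i : Fin n) : (((x i : ℕ) : ℝ) - ((a i : ℕ) : ℝ)) * b a x =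
    if (a i).1 + 1 < k i then (((a i : ℕ) : ℝ) + 1) * b (up i a) x else 0 := by
  have key : (((x i : ℕ) : ℝ) - ((a i : ℕ) : ℝ)) * ((Nat.choose (x i) (a i) : ℕ) : ℝ)
      = (((a i : ℕ) : ℝ) + 1) * ((Nat.choose (x i) ((a i : ℕ) + 1) : ℕ) : ℝ) := by
    have h := Nat.choose_succ_right_eq (x i : ℕ) (a i : ℕ)
    by_cases hle : (a i : ℕ) ≤ (x i : ℕ)
    · have h' : ((Nat.choose (x i) ((a i : ℕ) + 1) : ℕ) : ℝ) * (((a i : ℕ) : ℝ) + 1)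
        = ((Nat.choose (x i) (a i) : ℕ) : ℝ) * (((x i : ℕ) : ℝ) - ((a i : ℕ) : ℝ)) := by
        rw [← Nat.cast_sub hle]; exact_mod_cast h
      linarith
    · rw [Nat.choose_eq_zero_of_lt (by omega), Nat.choose_eq_zero_of_lt (by omega)]; simp
  split_ifs with h
  · unfold b
    rw [← Finset.mul_prod_erase _ _ (Finset.mem_univ i),
      ← Finset.mul_prod_erase (f := fun j => ((Nat.choose (x j) (up i a j) : ℕ) : ℝ)) _
        (Finset.mem_univ i), up_same h, ← mul_assoc, key, mul_assoc]
    congr 2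
    exact Finset.prod_congr rfl fun j hj => by rw [up_ne (Finset.ne_of_mem_erase hj)]
  · unfold b
    rw [← Finset.mul_prod_erase _ _ (Finset.mem_univ i), ← mul_assoc, key]
    have := (x i).2
    rw [Nat.choose_eq_zero_of_lt (by omega)]; simp

noncomputable def T : (Gd k → ℝ) →ₗ[ℝ] (Gd k → ℝ) where
  toFun f := fun x => ∑ a, f a * b a x
  map_add' g h := by funext x; simp [add_mul, Finset.sum_add_distrib]
  map_smul' c g := by
    funext x; simp [Finset.mul_sum]; exact Finset.sum_congr rfl fun i _ => by ring

lemma T_apply (f : Gd k → ℝ) (x : Gd k) : T f x = ∑ a, f a * b a x := rfl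

lemma T_lt {t : ℕ} {f : Gd k → ℝ} (hf : f ∈ lay t) {x : Gd k} (hx : wt x < t) : T f x = 0 := by
  rw [T_apply]
  refine Finset.sum_eq_zero fun a _ => ?_
  by_cases h : wt a = t
  · rw [b_wt (by omega) (by rintro rfl; omega), mul_zero]
  · rw [hf a h, zero_mul]

lemma T_eq {t : ℕ} {f : Gd k → ℝ} (hf : f ∈ lay t) {x : Gd k} (hx : wt x = t) :
    T f x = f x := by
  rw [T_apply, Finset.sum_eq_single x, b_self, mul_one]
  · intro a _ hne
    by_cases h : wt a = t
    · rw [b_wt (by omega) hne.symm, mul_zero]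
    · rw [hf a h, zero_mul]
  · simp

lemma T_U {t : ℕ} {f : Gd k → ℝ} (hf : f ∈ lay t) (x : Gd k) :
    T (U f) x = ((wt x : ℝ) - t) * T f x := by
  have h1 : T (U f) x = ∑ i, ∑ a : Gd k, ((a i : ℕ) : ℝ) * f (dn i a) * b a x := by
    rw [T_apply, Finset.sum_comm]
    simp only [U_apply, Finset.sum_mul]
  have h2 : ((wt x : ℝ) - t) * T f x =
      ∑ i, ∑ a : Gd k, f a * ((((x i : ℕ) : ℝ) - ((a i : ℕ) : ℝ)) * b a x) := by
    rw [Finset.sum_comm, T_apply, Finset.mul_sum]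
    refine Finset.sum_congr rfl fun a _ => ?_
    rw [← Finset.mul_sum, ← Finset.sum_mul, Finset.sum_sub_distrib]
    by_cases h : wt a = t
    · rw [← h]; simp only [wt]; push_cast; ring
    · rw [hf a h]; simp
  rw [h1, h2]
  refine Finset.sum_congr rfl fun i _ => ?_
  simp only [b_mul, mul_ite, mul_zero]
  rw [← Finset.sum_filter, ← Finset.sum_filter_add_sum_filter_not _ (fun a : Gd k => (a i).1 = 0),
    Finset.sum_eq_zero, zero_add]
  · refine Finset.sum_nbij' (fun a => dn i a) (fun a => up i a) ?_ ?_ ?_ ?_ ?_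
    · intro a ha
      simp only [Finset.mem_filter, Finset.mem_univ, true_and] at ha ⊢
      rw [dn_same]; have := (a i).2; omega
    · intro a ha
      simp only [Finset.mem_filter, Finset.mem_univ, true_and] at ha ⊢
      rw [up_same ha]; omega
    · intro a ha
      simp only [Finset.mem_filter, Finset.mem_univ, true_and] at ha
      exact up_dn ha
    · intro a ha
      simp only [Finset.mem_filter, Finset.mem_univ, true_and] at ha
      exact dn_up ha
    · intro a ha
      simp only [Finset.mem_filter, Finset.mem_univ, true_and] at ha
      rw [up_dn ha, dn_same, Nat.cast_sub (by omega)]; push_cast; ring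
  · intro a ha
    simp only [Finset.mem_filter, Finset.mem_univ, true_and] at ha
    rw [ha]; simp

lemma T_Upow_aux (m : ℕ) : ∀ {t : ℕ} {f : Gd k → ℝ}, f ∈ lay t → ∀ x : Gd k, wt x = t + m →
    (U ^ m) f x = (m.factorial : ℝ) * T f x := by
  induction m with
  | zero => intro t f hf x hx; simp [T_eq hf (by simpa using hx)]
  | succ m ih =>
    intro t f hf x hx
    rw [pow_succ, Module.End.mul_apply, ih (U_mem hf) x (by omega), T_U hf, hx, Nat.factorial_succ]
    push_cast; ring

lemma T_vanish {t v : ℕ} (h : t ≤ v) {f : Gd k → ℝ} (hf : f ∈ lay t) :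
    (U ^ (v - t)) f = 0 ↔ ∀ x, wt x = v → T f x = 0 := by
  constructor
  · intro h0 x hx
    have := T_Upow_aux (v - t) hf x (by omega)
    rw [h0] at this
    exact (mul_eq_zero.1 this.symm).resolve_left (by positivity)
  · intro h0
    funext x
    by_cases hx : wt x = v
    · rw [T_Upow_aux (v - t) hf x (by omega), h0 x hx]; simp
    · exact Upow_mem hf (v - t) x (by omega)

lemma T_vanish_mono {t v v' : ℕ} (h : t ≤ v) (hv : v ≤ v') {f : Gd k → ℝ} (hf : f ∈ lay t)
    (h0 : ∀ x, wt x = v → T f x = 0) : ∀ x, wt x = v' → T f x = 0 := by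
  rw [← T_vanish (h.trans hv) hf]
  rw [← T_vanish h hf] at h0
  rw [show v' - t = (v' - v) + (v - t) by omega, pow_add, Module.End.mul_apply, h0, map_zero]

def cst (x : Gd k) : Fin n → ℝ := fun i => ((x i : ℕ) : ℝ)

lemma b_poly (m : ℕ) : ∀ a : Gd k, wt a = m → ∃ p : MvPolynomial (Fin n) ℝ, p.totalDegree ≤ m ∧
    ∀ x : Gd k, MvPolynomial.eval (cst x) p = b a x := by
  induction m with
  | zero =>
    intro a ha
    refine ⟨1, by simp, fun x => ?_⟩
    have : ∀ i, (a i).1 = 0 := by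
      intro i; exact (Finset.sum_eq_zero_iff.1 ha) i (Finset.mem_univ i)
    simp [b, this]
  | succ m ih =>
    intro a ha
    obtain ⟨i, hi⟩ : ∃ i, (a i).1 ≠ 0 := by
      by_contra hcon
      push Not at hcon
      simp [wt, hcon] at ha
    have hw := wt_dn hi
    obtain ⟨p, hp, hpe⟩ := ih (dn i a) (by omega)
    have h1 : (dn i a i).1 + 1 < k i := by rw [dn_same]; have := (a i).2; omega
    refine ⟨(MvPolynomial.C ((((dn i a i : Fin (k i)) : ℕ) : ℝ) + 1)⁻¹ *
      (MvPolynomial.X i - MvPolynomial.C (((dn i a i : Fin (k i)) : ℕ) : ℝ))) * p, ?_, ?_⟩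
    · refine (MvPolynomial.totalDegree_mul _ _).trans ?_
      have h2 : (MvPolynomial.C ((((dn i a i : Fin (k i)) : ℕ) : ℝ) + 1)⁻¹ *
        (MvPolynomial.X i - MvPolynomial.C (((dn i a i : Fin (k i)) : ℕ) : ℝ)) :
          MvPolynomial (Fin n) ℝ).totalDegree ≤ 1 := by
        refine (MvPolynomial.totalDegree_mul _ _).trans ?_
        rw [MvPolynomial.totalDegree_C, zero_add]
        refine (MvPolynomial.totalDegree_sub _ _).trans ?_
        rw [MvPolynomial.totalDegree_C, MvPolynomial.totalDegree_X]
        simp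
      omega
    · intro x
      have h3 := b_mul (dn i a) x i
      rw [if_pos h1, up_dn hi] at h3
      have hpos : ((((dn i a i : Fin (k i)) : ℕ) : ℝ) + 1) ≠ 0 := by positivity
      simp only [map_mul, map_sub, MvPolynomial.eval_C, MvPolynomial.eval_X, hpe]
      rw [mul_assoc, show cst x i = ((x i : ℕ) : ℝ) from rfl, h3]
      field_simp

lemma T_poly {t : ℕ} {f : Gd k → ℝ} (hf : f ∈ lay t) : ∃ p : MvPolynomial (Fin n) ℝ,
    p.totalDegree ≤ t ∧ ∀ x : Gd k, MvPolynomial.eval (cst x) p = T f x := by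
  choose P hP hPe using fun a : Gd k => b_poly (wt a) a rfl
  refine ⟨∑ a, MvPolynomial.C (f a) * P a, ?_, ?_⟩
  · refine (MvPolynomial.totalDegree_finsetSum _ _).trans (Finset.sup_le fun a _ => ?_)
    by_cases h : wt a = t
    · refine (MvPolynomial.totalDegree_mul _ _).trans ?_
      rw [MvPolynomial.totalDegree_C, zero_add, ← h]; exact hP a
    · rw [hf a h]; simp
  · intro x
    simp [T_apply, hPe]

/-- span of the products of binomials of weight at most `d`. -/
noncomputable def S (k : Fin n → ℕ) (d : ℕ) : Submodule ℝ (Gd k → ℝ) :=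
  Submodule.span ℝ (b '' {a : Gd k | wt a ≤ d})

lemma S_mul (i : Fin n) {d : ℕ} {g : Gd k → ℝ} (hg : g ∈ S k d) :
    (fun x => ((x i : ℕ) : ℝ) * g x) ∈ S k (d + 1) := by
  unfold S at hg
  induction hg using Submodule.span_induction with
  | mem g hg =>
    obtain ⟨a, ha, rfl⟩ := hg
    have ha' : wt a ≤ d := ha
    have e : (fun x : Gd k => ((x i : ℕ) : ℝ) * b a x) = ((a i : ℕ) : ℝ) • b a +
        (if (a i).1 + 1 < k i then (((a i : ℕ) : ℝ) + 1) • b (up i a) else 0) := by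
      funext x
      have := b_mul a x i
      split_ifs at this ⊢ with h
      · simp only [Pi.add_apply, Pi.smul_apply, smul_eq_mul]; linarith
      · simp only [Pi.add_apply, Pi.smul_apply, smul_eq_mul, Pi.zero_apply]; linarith
    rw [e]
    refine Submodule.add_mem _ (Submodule.smul_mem _ _ (Submodule.subset_span
      ⟨a, by simp only [Set.mem_ofPred_eq]; omega, rfl⟩)) ?_
    split_ifs with h
    · exact Submodule.smul_mem _ _ (Submodule.subset_span
        ⟨up i a, by simp only [Set.mem_ofPred_eq]; rw [wt_up h]; omega, rfl⟩)
    · exact Submodule.zero_mem _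
  | zero => convert Submodule.zero_mem (S k (d + 1)) using 1; funext x; simp
  | add g h _ _ hg hh =>
    convert Submodule.add_mem _ hg hh using 1
    funext x; simp [mul_add]
  | smul c g _ hg =>
    have := Submodule.smul_mem _ c hg
    convert this using 1
    funext x; simp; ring

lemma S_mono {d e : ℕ} (h : d ≤ e) : S k d ≤ S k e :=
  Submodule.span_mono (Set.image_mono fun _ ha => le_trans ha h)

lemma S_one (hk : ∀ i, 1 ≤ k i) : (fun _ => 1) ∈ S k 0 :=
  Submodule.subset_span ⟨fun i => ⟨0, hk i⟩, by simp [wt], by funext x; simp [b]⟩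

lemma poly_S (hk : ∀ i, 1 ≤ k i) {d : ℕ} {p : MvPolynomial (Fin n) ℝ} (hp : p.totalDegree ≤ d) :
    (fun x : Gd k => MvPolynomial.eval (cst x) p) ∈ S k d := by
  have mon : ∀ m : Fin n →₀ ℕ, (fun x : Gd k => MvPolynomial.eval (cst x)
      (MvPolynomial.monomial m (1:ℝ))) ∈ S k (m.sum fun _ e => e) := by
    intro m
    induction m using Finsupp.induction with
    | zero => simpa using S_one hk
    | single_add i e m _ _ hm =>
      rw [Finsupp.sum_add_index' (fun _ => rfl) (fun _ _ _ => rfl), Finsupp.sum_single_index rfl]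
      have key : ∀ e : ℕ, (fun x : Gd k => MvPolynomial.eval (cst x)
          (MvPolynomial.monomial (Finsupp.single i e + m) (1:ℝ))) ∈
            S k (e + m.sum fun _ e => e) := by
        intro e
        induction e with
        | zero => simpa using hm
        | succ e ih =>
          convert S_mul i ih using 1
          · congr 1; omega
          · funext x
            rw [Finsupp.single_add, add_comm (Finsupp.single i e), add_assoc,
              MvPolynomial.monomial_single_add, map_mul]
            simp [cst]
      exact key e
  have e : (fun x : Gd k => MvPolynomial.eval (cst x) p) = ∑ v ∈ p.support,
      MvPolynomial.coeff v p • (fun x : Gd k => MvPolynomial.eval (cst x)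
        (MvPolynomial.monomial v (1:ℝ))) := by
    funext x
    conv_lhs => rw [p.as_sum]
    rw [map_sum, Finset.sum_apply]
    refine Finset.sum_congr rfl fun v _ => ?_
    rw [Pi.smul_apply, MvPolynomial.eval_monomial, MvPolynomial.eval_monomial, one_mul, smul_eq_mul]
  rw [e]
  exact Submodule.sum_mem _ fun v hv => Submodule.smul_mem _ _
    (S_mono ((MvPolynomial.le_totalDegree hv).trans hp) (mon v))

/-- The polynomial vanishing on `w s`, `s ∈ I`, `s > t`. -/
noncomputable def Np (c d : ℕ) (w : ℕ → ℕ) (t : ℕ) : Polynomial ℝ :=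
  ∏ s ∈ (Finset.Icc c d).filter (fun s => t < s), (Polynomial.X - Polynomial.C ((w s : ℕ) : ℝ))

lemma Np_card (c d t : ℕ) : ((Finset.Icc c d).filter (fun s => t < s)).card ≤ d - t := by
  have : (Finset.Icc c d).filter (fun s => t < s) ⊆ Finset.Ioc t d := by
    intro s hs
    simp only [Finset.mem_filter, Finset.mem_Icc, Finset.mem_Ioc] at hs ⊢
    omega
  simpa using Finset.card_le_card this

lemma Np_eval (c d : ℕ) (w : ℕ → ℕ) (t : ℕ) (y : ℝ) : (Np c d w t).eval y =
    ∏ s ∈ (Finset.Icc c d).filter (fun s => t < s), (y - ((w s : ℕ) : ℝ)) := by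
  simp [Np, Polynomial.eval_prod]

lemma Np_natDegree (c d : ℕ) (w : ℕ → ℕ) (t : ℕ) : (Np c d w t).natDegree ≤ d - t := by
  refine (Polynomial.natDegree_prod_le _ _).trans ?_
  simp only [Function.comp_def, Polynomial.natDegree_X_sub_C]
  simpa using Np_card c d t

lemma Np_poly (n c d : ℕ) (w : ℕ → ℕ) (t : ℕ) : ∃ p : MvPolynomial (Fin n) ℝ,
    p.totalDegree ≤ d - t ∧ ∀ x : Fin n → ℝ,
      MvPolynomial.eval x p = (Np c d w t).eval (∑ i, x i) := by
  refine ⟨∏ s ∈ (Finset.Icc c d).filter (fun s => t < s),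
    ((∑ i, MvPolynomial.X i) - MvPolynomial.C ((w s : ℕ) : ℝ)), ?_, ?_⟩
  · refine (MvPolynomial.totalDegree_finsetProd _ _).trans ?_
    refine le_trans (Finset.sum_le_card_nsmul _ _ 1 fun s _ => ?_) (by simpa using Np_card c d t)
    refine (MvPolynomial.totalDegree_sub _ _).trans (max_le ?_ ?_)
    · refine (MvPolynomial.totalDegree_finsetSum _ _).trans (Finset.sup_le fun i _ => ?_)
      rw [MvPolynomial.totalDegree_X]
    · rw [MvPolynomial.totalDegree_C]; omega
  · intro x
    rw [Np_eval, map_prod]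
    simp

end HF

/-- Affine Hilbert functions of interval-compatible weight-determined sets:
for an interval `I = [c,d] ⊆ [0,N]` and an `I`-compatible set `E = {w_t : t ∈ I}`,
`H_d(E̲) = ∑_{t ∈ I} min{[G choose t], [G choose w_t]}`. -/
theorem stmt_13 (n : ℕ) (k : Fin n → ℕ) (hk : ∀ i, 2 ≤ k i)
    (N : ℕ) (hN : N = ∑ i, (k i - 1)) (c d : ℕ) (hcd : c ≤ d) (hdN : d ≤ N)
    (w : ℕ → ℕ)
    (hwN : ∀ t ∈ Finset.Icc c d, w t ≤ N)
    (hdistinct : Set.InjOn w (Finset.Icc c d))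
    (hge : ∀ t ∈ Finset.Icc c d, t ≤ w t)
    (hbig : ∀ t ∈ Finset.Icc c d, w t ≠ t → d < w t)
    (hdec : ∀ s ∈ Finset.Icc c d, ∀ t ∈ Finset.Icc c d, s < t →
      w s ∉ Finset.Icc c d → w t ∉ Finset.Icc c d → w t < w s) :
    hilbertFn n (underlineR n k ↑((Finset.Icc c d).image w)) d =
      ∑ t ∈ Finset.Icc c d, min (layerCard n k t) (layerCard n k (w t)) := by
    classical
  have hk1 : ∀ i, 1 ≤ k i := fun i => by have := hk i; omega
  set A := underlineR n k ↑((Finset.Icc c d).image w) with hAdef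
  have hA : ∀ a : A, ∃ x : HF.Gd k, HF.cst x = (a : Fin n → ℝ) ∧
      ∃ t ∈ Finset.Icc c d, HF.wt x = w t := by
    rintro ⟨a, ha, e, he, hsum⟩
    have ha2 : ∀ i, ∃ m : ℕ, m < k i ∧ a i = m := ha
    choose x hx hxa using ha2
    rw [Finset.coe_image] at he
    obtain ⟨t, ht, rfl⟩ := he
    refine ⟨fun i => ⟨x i, hx i⟩, ?_, t, ht, ?_⟩
    · funext i; simp [HF.cst, hxa]
    · have : ((∑ i, x i : ℕ) : ℝ) = (w t : ℝ) := by
        rw [← hsum]; push_cast; exact Finset.sum_congr rfl fun i _ => (hxa i).symm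
      exact_mod_cast this
  choose π hπ hπw using hA
  have hsurj : ∀ (x : HF.Gd k) (t : ℕ), t ∈ Finset.Icc c d → HF.wt x = w t → ∃ a : A, π a = x := by
    intro x t ht hx
    have hmem : HF.cst x ∈ A := by
      refine ⟨fun i => ⟨x i, (x i).2, rfl⟩, w t, ?_, ?_⟩
      · rw [Finset.coe_image]; exact ⟨t, ht, rfl⟩
      · rw [← hx]; simp [HF.cst, HF.wt]
    refine ⟨⟨_, hmem⟩, ?_⟩
    have h := hπ ⟨_, hmem⟩
    funext i
    have h1 := congrFun h i
    apply Fin.ext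
    simp only [HF.cst] at h1
    exact_mod_cast h1
  let Ψ : ℕ → ((HF.Gd k → ℝ) →ₗ[ℝ] (A → ℝ)) := fun t =>
    { toFun := fun f a => HF.T f (π a) * (HF.Np c d w t).eval ((HF.wt (π a) : ℕ) : ℝ)
      map_add' := by intro f g; funext a; simp [add_mul]
      map_smul' := by intro r f; funext a; simp [mul_assoc] }
  have hΨ : ∀ t f a, Ψ t f a = HF.T f (π a) * (HF.Np c d w t).eval ((HF.wt (π a) : ℕ) : ℝ) :=
    fun _ _ _ => rfl
  have Np_zero : ∀ s t, t ∈ Finset.Icc c d → s < t →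
      (HF.Np c d w s).eval ((w t : ℕ) : ℝ) = 0 := by
    intro s t ht hst
    rw [HF.Np_eval]
    exact Finset.prod_eq_zero (i := t) (by simp only [Finset.mem_filter]; exact ⟨ht, hst⟩) (by simp)
  have Np_self : ∀ t ∈ Finset.Icc c d, (HF.Np c d w t).eval ((w t : ℕ) : ℝ) ≠ 0 := by
    intro t ht
    rw [HF.Np_eval, Finset.prod_ne_zero_iff]
    intro s hs
    simp only [Finset.mem_filter] at hs
    rw [sub_ne_zero]
    intro h
    have : w t = w s := by exact_mod_cast h
    have := hdistinct (by exact_mod_cast ht) (by exact_mod_cast hs.1) this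
    omega
  have Np_at : ∀ t, (HF.Np c d w t).eval ((t : ℕ) : ℝ) ≠ 0 := by
    intro t
    rw [HF.Np_eval, Finset.prod_ne_zero_iff]
    intro s hs
    simp only [Finset.mem_filter] at hs
    rw [sub_ne_zero]
    intro h
    have h1 : t = w s := by exact_mod_cast h
    have := hge s hs.1
    omega
  -- vanishing on one layer forces vanishing everywhere
  have hK : ∀ t ∈ Finset.Icc c d, ∀ f ∈ HF.lay (k := k) t,
      (∀ a, HF.wt (π a) = w t → Ψ t f a = 0) → (∀ x, HF.wt x = w t → HF.T f x = 0) := by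
    intro t ht f _ h x hx
    obtain ⟨a, rfl⟩ := hsurj x t ht hx
    have := h a hx
    rw [hΨ, hx] at this
    exact (mul_eq_zero.1 this).resolve_right (Np_self t ht)
  have hK2 : ∀ t ∈ Finset.Icc c d, ∀ f ∈ HF.lay (k := k) t,
      (∀ x, HF.wt x = w t → HF.T f x = 0) → Ψ t f = 0 := by
    intro t ht f hf h
    funext a
    rw [hΨ, Pi.zero_apply]
    obtain ⟨s, hs, hsw⟩ := hπw a
    rcases lt_trichotomy s t with hst | hst | hst
    · by_cases hws : w s = s
      · rw [HF.T_lt hf (by omega), zero_mul]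
      · have h1 := hbig s hs hws
        have h2 : w t ≤ w s := by
          by_cases hwt : w t = t
          · have := (Finset.mem_Icc.1 ht).2; omega
          · have h3 := hbig t ht hwt
            exact (hdec s hs t ht hst (by simp only [Finset.mem_Icc]; omega)
              (by simp only [Finset.mem_Icc]; omega)).le
        rw [HF.T_vanish_mono (hge t ht) h2 hf h _ hsw, zero_mul]
    · subst hst; rw [h _ hsw, zero_mul]
    · rw [hsw, Np_zero t s hs hst, mul_zero]
  let R : ↥(Finset.Icc c d) → Submodule ℝ (A → ℝ) := fun t => (HF.lay (k := k) t.1).map (Ψ t.1)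
  have hR : ∀ t : ↥(Finset.Icc c d), Module.finrank ℝ (R t) =
      min (layerCard n k t.1) (layerCard n k (w t.1)) := by
    intro t
    rw [← HF.rank_U hk1 hN (hge t.1 t.2) (hwN t.1 t.2)]
    refine HF.finrank_map_congr _ _ _ fun f hf => ?_
    rw [HF.T_vanish (hge t.1 t.2) hf]
    exact ⟨fun h => hK t.1 t.2 f hf (fun a _ => by rw [h]; rfl), hK2 t.1 t.2 f hf⟩
  let Sg : ((t : ↥(Finset.Icc c d)) → R t) →ₗ[ℝ] (A → ℝ) :=
    ∑ t, (R t).subtype ∘ₗ LinearMap.proj t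
  have hSg : ∀ y, Sg y = ∑ t, (y t : A → ℝ) := by
    intro y; simp [Sg]
  have hinj : Function.Injective Sg := by
    rw [injective_iff_map_eq_zero]
    intro y hy
    rw [hSg] at hy
    have step : ∀ j : ℕ, ∀ t : ↥(Finset.Icc c d), t.1 + j = d → y t = 0 := by
      intro j
      induction j using Nat.strong_induction_on with
      | _ j ih =>
        intro t htj
        obtain ⟨f, hf, hfy⟩ := (y t).2
        apply Subtype.ext
        rw [← hfy]
        refine hK2 t.1 t.2 f hf (hK t.1 t.2 f hf fun a ha => ?_)
        have h1 := congrFun hy a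
        rw [Finset.sum_apply, Finset.sum_eq_single t] at h1
        · rw [hfy]; exact h1
        · intro s _ hst
          rcases lt_trichotomy s.1 t.1 with h | h | h
          · obtain ⟨g, hg, hgy⟩ := (y s).2
            rw [← hgy, hΨ, ha, Np_zero s.1 t.1 t.2 h, mul_zero]
          · exact absurd (Subtype.ext h) hst
          · have hs := (Finset.mem_Icc.1 s.2).2
            rw [ih (d - s.1) (by omega) s (by omega)]; rfl
        · intro h; exact absurd (Finset.mem_univ _) h
    funext t
    exact step (d - t.1) t (by have := (Finset.mem_Icc.1 t.2).2; omega)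
  have hRle : ∀ t, R t ≤ LinearMap.range Sg := by
    intro t y hy
    refine ⟨Pi.single t ⟨y, hy⟩, ?_⟩
    rw [hSg, Finset.sum_eq_single t]
    · simp
    · intro s _ hst; simp [Pi.single_eq_of_ne hst]
    · simp
  -- spanning
  have hspan : ∀ j s, s + j = d → ∀ f ∈ HF.lay (k := k) s, ∀ g : Polynomial ℝ, g.natDegree ≤ j →
      (fun a : A => HF.T f (π a) * g.eval ((HF.wt (π a) : ℕ) : ℝ)) ∈ LinearMap.range Sg := by
    have base : ∀ s, s ≤ d → ∀ f ∈ HF.lay (k := k) s, Ψ s f ∈ LinearMap.range Sg := by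
      intro s hs f hf
      by_cases hsc : c ≤ s
      · exact hRle ⟨s, Finset.mem_Icc.2 ⟨hsc, hs⟩⟩ ⟨f, hf, rfl⟩
      · convert Submodule.zero_mem (LinearMap.range Sg) using 1
        funext a
        obtain ⟨t, ht, htw⟩ := hπw a
        rw [hΨ, htw, Np_zero s t ht (by have := (Finset.mem_Icc.1 ht).1; omega)]
        simp
    intro j
    induction j with
    | zero =>
      intro s hs f hf g hg
      have h1 := Submodule.smul_mem _ (g.coeff 0) (base s (by omega) f hf)
      convert h1 using 1
      funext a
      rw [Pi.smul_apply, hΨ, Polynomial.eq_C_of_natDegree_le_zero hg,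
        Polynomial.eq_C_of_natDegree_le_zero (p := HF.Np c d w s)
          ((HF.Np_natDegree c d w s).trans (by omega))]
      have : (HF.Np c d w s) = 1 := by
        unfold HF.Np
        rw [Finset.filter_false_of_mem, Finset.prod_empty]
        intro t ht
        have := (Finset.mem_Icc.1 ht).2; omega
      rw [this]
      simp [mul_comm]
    | succ j ih =>
      intro s hs f hf g hg
      set α : ℝ := g.eval (s : ℝ) / (HF.Np c d w s).eval (s : ℝ) with hα
      set h : Polynomial ℝ := g - Polynomial.C α * HF.Np c d w s with hh
      have hroot : h.IsRoot (s : ℝ) := by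
        have := Np_at s
        simp only [Polynomial.IsRoot.def, hh, Polynomial.eval_sub, Polynomial.eval_mul,
          Polynomial.eval_C, hα]
        field_simp
        ring
      have hdeg : h.natDegree ≤ j + 1 := by
        refine (Polynomial.natDegree_sub_le _ _).trans (max_le hg ?_)
        refine (Polynomial.natDegree_C_mul_le _ _).trans ((HF.Np_natDegree c d w s).trans ?_)
        omega
      obtain ⟨q, hq⟩ := Polynomial.dvd_iff_isRoot.2 hroot
      have hqdeg : q.natDegree ≤ j := by
        by_cases hq0 : q = 0
        · simp [hq0]
        · rw [hq, Polynomial.natDegree_mul (Polynomial.X_sub_C_ne_zero _) hq0,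
            Polynomial.natDegree_X_sub_C] at hdeg
          omega
      have h1 := Submodule.smul_mem _ α (base s (by omega) f hf)
      have h2 := ih (s + 1) (by omega) (HF.U f) (HF.U_mem hf) q hqdeg
      convert Submodule.add_mem _ h1 h2 using 1
      funext a
      rw [Pi.add_apply, Pi.smul_apply, hΨ, HF.T_U hf, smul_eq_mul]
      have hg2 : g = Polynomial.C α * HF.Np c d w s + (Polynomial.X - Polynomial.C (s:ℝ)) * q := by
        rw [← hq, hh]; ring
      conv_lhs => rw [hg2]
      simp only [Polynomial.eval_add, Polynomial.eval_mul, Polynomial.eval_sub, Polynomial.eval_C,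
        Polynomial.eval_X]
      ring
  have hrange : (MvPolynomial.restrictTotalDegree (Fin n) ℝ d).map (evalLM n A) =
      LinearMap.range Sg := by
    apply le_antisymm
    · rintro _ ⟨p, hp, rfl⟩
      have hp' : p.totalDegree ≤ d := (MvPolynomial.mem_restrictTotalDegree _ _ _).1 hp
      have h1 := HF.poly_S hk1 hp'
      have h2 : evalLM n A p = LinearMap.funLeft ℝ ℝ π
          (fun x => MvPolynomial.eval (HF.cst x) p) := by
        funext a
        simp only [LinearMap.funLeft_apply, hπ]
        rfl
      rw [h2]
      have h3 : HF.S k d ≤ (LinearMap.range Sg).comap (LinearMap.funLeft ℝ ℝ π) := by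
        unfold HF.S
        rw [Submodule.span_le]
        rintro _ ⟨a, ha, rfl⟩
        have ha' : HF.wt a ≤ d := ha
        have hl : (Pi.single a 1 : HF.Gd k → ℝ) ∈ HF.lay (HF.wt a) := by
          intro x hx
          exact Pi.single_eq_of_ne (by rintro rfl; exact hx rfl) _
        have h4 := hspan (d - HF.wt a) (HF.wt a) (by omega) _ hl 1 (by simp)
        rw [SetLike.mem_coe, Submodule.mem_comap]
        convert h4 using 1
        funext y
        rw [LinearMap.funLeft_apply, HF.T_apply, Finset.sum_eq_single a]
        · simp
        · intro x _ hx; simp [Pi.single_eq_of_ne hx]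
        · simp
      exact h3 h1
    · rintro _ ⟨y, rfl⟩
      rw [hSg]
      refine Submodule.sum_mem _ fun t _ => ?_
      obtain ⟨f, hf, hfy⟩ := (y t).2
      rw [← hfy]
      obtain ⟨p, hp, hpe⟩ := HF.T_poly hf
      obtain ⟨q, hq, hqe⟩ := HF.Np_poly n c d w t.1
      refine ⟨p * q, ?_, ?_⟩
      · refine (MvPolynomial.mem_restrictTotalDegree _ _ _).2 ?_
        refine (MvPolynomial.totalDegree_mul _ _).trans ?_
        have := (Finset.mem_Icc.1 t.2).2; omega
      · funext a
        have : evalLM n A (p * q) a = MvPolynomial.eval (HF.cst (π a)) (p * q) := by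
          rw [hπ]; rfl
        rw [this, map_mul, hpe, hqe, hΨ]
        simp [HF.cst, HF.wt]
  unfold hilbertFn
  rw [hrange, LinearMap.finrank_range_of_inj hinj, Module.finrank_pi_fintype]
  simp only [hR]
  exact Finset.sum_coe_sort (Finset.Icc c d)
    (fun t => min (layerCard n k t) (layerCard n k (w t)))
end

section
/- Let G be a uniform grid, d ∈ [0,N], and E ⊆ [0,N]. If ({t_ℓ < ⋯ < t₁}, {w₁ < ⋯ < w_r}) is the (N,d)-BE enumeration of E (i.e., [0,d]∖E = {t_ℓ<⋯<t₁} and E∖[0,d] = {w₁<⋯<w_r}), then H_d(E̲) = Σ_{w ∈ E∩[0,d]} [G choose w] + Σ_{j=1}^{min{ℓ,r}} min{[G choose t_j], [G choose w_j]}. -/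
open scoped Classical

structure LData (V : Type) [AddCommGroup V] [Module ℝ V] (N : ℕ) where
  U : V →ₗ[ℝ] V
  D : V →ₗ[ℝ] V
  L : ℕ → Submodule ℝ V
  B : LinearMap.BilinForm ℝ V
  hU : ∀ i v, v ∈ L i → U v ∈ L (i+1)
  hD : ∀ i v, v ∈ L (i+1) → D v ∈ L i
  hD0 : ∀ v, v ∈ L 0 → D v = 0
  comm : ∀ i v, v ∈ L i → D (U v) = U (D v) + ((N:ℝ) - 2 * i) • v
  symm : ∀ v w, B v w = B w v
  pos : ∀ v, v ≠ 0 → 0 < B v v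
  adj : ∀ v w, B (U v) w = B v (D w)

namespace LData

variable {V : Type} [AddCommGroup V] [Module ℝ V] {N : ℕ} (S : LData V N)

/-- primitive vectors -/
def H (i : ℕ) : Submodule ℝ V := S.L i ⊓ LinearMap.ker S.D

lemma eq_zero_of_B {v : V} (h : S.B v v ≤ 0) : v = 0 := by
  by_contra hv
  exact absurd (S.pos v hv) (not_lt.mpr h)

lemma powU_mem {i : ℕ} {v : V} (hv : v ∈ S.L i) (m : ℕ) : (S.U ^ m) v ∈ S.L (i + m) := by
  induction m with
  | zero => simpa using hv
  | succ m ih =>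
    rw [pow_succ']
    exact S.hU _ _ ih

lemma eig {i : ℕ} {h : V} (hh : h ∈ S.H i) (m : ℕ) :
    S.U (S.D ((S.U ^ m) h)) = ((m:ℝ) * (N - 2 * i - m + 1)) • (S.U ^ m) h := by
  obtain ⟨h1, h2⟩ := hh
  have h2 : S.D h = 0 := h2
  induction m with
  | zero => simp [h2]
  | succ m ih =>
    have hm := S.powU_mem h1 m
    have e : (S.U ^ (m+1)) h = S.U ((S.U ^ m) h) := by rw [pow_succ']; rfl
    rw [e, S.comm _ _ hm, ih, ← add_smul, map_smul]
    congr 1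
    push_cast
    ring

lemma DU {i : ℕ} {h : V} (hh : h ∈ S.H i) (m : ℕ) :
    S.D (S.U ((S.U ^ m) h)) = (((m:ℝ)+1) * (N - 2 * i - m)) • (S.U ^ m) h := by
  rw [S.comm _ _ (S.powU_mem hh.1 m), S.eig hh, ← add_smul]
  congr 1
  push_cast
  ring

lemma inj {i : ℕ} {h : V} (hh : h ∈ S.H i) (m : ℕ) (hm : m + 2 * i ≤ N)
    (h0 : (S.U ^ m) h = 0) : h = 0 := by
  induction m with
  | zero => simpa using h0
  | succ m ih =>
    apply ih (by omega)
    have e : (S.U ^ (m+1)) h = S.U ((S.U ^ m) h) := by rw [pow_succ']; rfl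
    have := S.DU hh m
    rw [← e, h0, map_zero] at this
    rcases smul_eq_zero.mp this.symm with h | h
    · exfalso
      have : ((m:ℝ) + 1 + 2 * i ≤ N) := by exact_mod_cast hm
      rcases mul_eq_zero.mp h with h | h
      · have : (0:ℝ) ≤ m := by positivity
        linarith
      · linarith
    · exact h

lemma vanish {i : ℕ} {h : V} (hh : h ∈ S.H i) (m : ℕ) (hm : N < m + 2 * i) :
    (S.U ^ m) h = 0 := by
  induction m with
  | zero =>
    have h1 := S.DU hh 0
    simp only [pow_zero, Module.End.one_apply] at h1 ⊢
    have h2 := S.adj h (S.U h)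
    rw [h1, map_smul, smul_eq_mul] at h2
    by_contra hne
    have h3 := S.pos h hne
    have h4 : (N:ℝ) < 2 * i := by
      have : N < 2 * i := by omega
      exact_mod_cast this
    have h5 : 0 ≤ S.B (S.U h) (S.U h) := by
      by_cases hz : S.U h = 0
      · simp [hz]
      · exact (S.pos _ hz).le
    rw [h2] at h5
    push_cast at h5
    nlinarith
  | succ m ih =>
    have e : (S.U ^ (m+1)) h = S.U ((S.U ^ m) h) := by rw [pow_succ']; rfl
    rw [e]
    by_cases hc : N < m + 2 * i
    · rw [ih hc, map_zero]
    · have hc : N = m + 2 * i := by omega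
      apply S.eq_zero_of_B
      rw [S.adj, S.DU hh m]
      have : (N:ℝ) - 2 * i - m = 0 := by rw [hc]; push_cast; ring
      rw [this]
      simp

lemma decomp [FiniteDimensional ℝ V] {d : ℕ} {v : V} (hv : v ∈ S.L (d+1)) :
    ∃ h ∈ S.H (d+1), ∃ u ∈ S.L d, v = h + S.U u := by
  set W := (S.L d).map S.U with hW
  have hdis : Disjoint W (S.B.orthogonal W) := by
    rw [Submodule.disjoint_def]
    intro x hx hx'
    apply S.eq_zero_of_B
    rw [LinearMap.BilinForm.mem_orthogonal_iff] at hx'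
    exact le_of_eq (hx' x hx)
  have hrefl : S.B.IsRefl := fun x y h => by rw [S.symm]; exact h
  have hc := (LinearMap.BilinForm.isCompl_orthogonal_iff_disjoint hrefl).mpr hdis
  have : v ∈ W ⊔ S.B.orthogonal W := by rw [hc.sup_eq_top]; trivial
  obtain ⟨w, hw, w', hw', e⟩ := Submodule.mem_sup.mp this
  obtain ⟨u, hu, rfl⟩ := hw
  have hw'L : w' ∈ S.L (d+1) := by
    have : w' = v - S.U u := by rw [← e]; abel
    rw [this]
    exact Submodule.sub_mem _ hv (S.hU _ _ hu)
  refine ⟨w', ⟨hw'L, ?_⟩, u, hu, by rw [← e]; abel⟩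
  rw [LinearMap.BilinForm.mem_orthogonal_iff] at hw'
  apply S.eq_zero_of_B
  rw [← S.adj]
  exact le_of_eq (hw' _ ⟨_, S.hD _ _ hw'L, rfl⟩)


lemma layer_indep (e : ℕ) (I : Finset ℕ) (hI : ∀ i ∈ I, i ≤ e ∧ e + i ≤ N) (w : ℕ → V)
    (hw : ∀ i ∈ I, w i ∈ S.H i) (h0 : ∑ i ∈ I, (S.U ^ (e - i)) (w i) = 0) :
    ∀ i ∈ I, w i = 0 := by
  have hind := Module.End.eigenspaces_iSupIndep (S.U ∘ₗ S.D)
  let lam : I → ℝ := fun i => ((e - i.1 : ℕ) : ℝ) * (N - 2 * i.1 - (e - i.1 : ℕ) + 1)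
  have hinj : Function.Injective lam := by
    intro i j hij
    have hi := hI i.1 i.2
    have hj := hI j.1 j.2
    simp only [lam] at hij
    rw [Nat.cast_sub hi.1, Nat.cast_sub hj.1] at hij
    have h1 : ((j.1:ℝ) - i.1) * (N + 1 - i.1 - j.1) = 0 := by linarith
    have h2 : (i.1 : ℝ) + j.1 ≤ N := by
      have : i.1 + j.1 ≤ N := by omega
      exact_mod_cast this
    rcases mul_eq_zero.mp h1 with h | h
    · apply Subtype.ext
      have : (j.1:ℝ) = i.1 := by linarith
      exact_mod_cast this.symm
    · linarith
  have hind2 := hind.comp hinj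
  rw [iSupIndep_iff_finsetSum_eq_zero_imp_eq_zero] at hind2
  have key := hind2 Finset.univ (fun i => (S.U ^ (e - i.1)) (w i.1)) (by
    intro i _
    simp only [Function.comp, Module.End.mem_eigenspace_iff]
    exact S.eig (hw i.1 i.2) (e - i.1)) (by
    rw [← h0]
    exact Finset.sum_coe_sort I (fun i => (S.U ^ (e - i)) (w i)))
  intro i hi
  have := hI i hi
  exact S.inj (hw i hi) (e - i) (by omega) (key ⟨i, hi⟩ (Finset.mem_univ _))

variable {X : Type} (s : X → ℕ) (Φ : V →ₗ[ℝ] (X → ℝ))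

lemma phi_pow (hΦ : ∀ i v, v ∈ S.L i → ∀ x, Φ (S.U v) x = ((s x : ℝ) - i) * Φ v x)
    {i : ℕ} {v : V} (hv : v ∈ S.L i) (x : X) (m : ℕ) :
    Φ ((S.U ^ m) v) x = (∏ t ∈ Finset.range m, ((s x : ℝ) - i - t)) * Φ v x := by
  induction m with
  | zero => simp
  | succ m ih =>
    have e : (S.U ^ (m+1)) v = S.U ((S.U ^ m) v) := by rw [pow_succ']; rfl
    rw [e, hΦ _ _ (S.powU_mem hv m), ih, Finset.prod_range_succ]
    push_cast
    ring

lemma phi_vanish (hΦ : ∀ i v, v ∈ S.L i → ∀ x, Φ (S.U v) x = ((s x : ℝ) - i) * Φ v x)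
    {i : ℕ} {h : V} (hh : h ∈ S.H i) (x : X) (hx : ¬ (i ≤ s x ∧ s x + i ≤ N)) :
    Φ h x = 0 := by
  obtain ⟨m, hm, hm2⟩ : ∃ m : ℕ, N < m + 2 * i ∧ (s x < i ∨ i + m ≤ s x) := by
    by_cases h : s x < i
    · exact ⟨N+1, by omega, Or.inl h⟩
    · exact ⟨s x - i, by omega, Or.inr (by omega)⟩
  have h1 := S.phi_pow s Φ hΦ hh.1 x m
  rw [S.vanish hh m hm, map_zero] at h1
  rcases mul_eq_zero.mp h1.symm with h | h
  · exfalso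
    obtain ⟨t, ht, h⟩ := Finset.prod_eq_zero_iff.mp h
    rw [Finset.mem_range] at ht
    have : (s x : ℝ) = ((i + t : ℕ) : ℝ) := by push_cast; linarith
    have : s x = i + t := by exact_mod_cast this
    omega
  · exact h

lemma phi_indep (hΦ : ∀ i v, v ∈ S.L i → ∀ x, Φ (S.U v) x = ((s x : ℝ) - i) * Φ v x)
    (e : ℕ) (hΦ2 : ∀ v ∈ S.L e, (∀ x, s x = e → Φ v x = 0) → v = 0)
    (I : Finset ℕ) (w : ℕ → V)
    (hw : ∀ i ∈ I, w i ∈ S.H i) (h0 : ∀ x, s x = e → ∑ i ∈ I, Φ (w i) x = 0) :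
    ∀ i ∈ I, (i ≤ e ∧ e + i ≤ N) → w i = 0 := by
  set I' := I.filter (fun i => i ≤ e ∧ e + i ≤ N) with hI'
  let c : ℕ → ℝ := fun i => (∏ t ∈ Finset.range (e - i), ((e : ℝ) - i - t))⁻¹
  have hc : ∀ i ∈ I', (∏ t ∈ Finset.range (e - i), ((e : ℝ) - i - t)) ≠ 0 := by
    intro i hi h
    obtain ⟨t, ht, h⟩ := Finset.prod_eq_zero_iff.mp h
    rw [Finset.mem_range] at ht
    have : (e : ℝ) = ((i + t : ℕ) : ℝ) := by push_cast; linarith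
    have : e = i + t := by exact_mod_cast this
    omega
  have hw' : ∀ i ∈ I', w i ∈ S.H i := fun i hi => hw i (Finset.mem_filter.mp hi).1
  have h1 : ∑ i ∈ I', (S.U ^ (e - i)) (c i • w i) = 0 := by
    apply hΦ2
    · apply Submodule.sum_mem
      intro i hi
      have := S.powU_mem (Submodule.smul_mem _ (c i) (hw' i hi).1) (e - i)
      rwa [Nat.add_sub_cancel' (Finset.mem_filter.mp hi).2.1] at this
    · intro x hx
      rw [map_sum, Finset.sum_apply, ← h0 x hx]
      symm
      rw [← Finset.sum_filter_add_sum_filter_not I (fun i => i ≤ e ∧ e + i ≤ N)]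
      rw [Finset.sum_eq_zero (s := I.filter (fun i => ¬ (i ≤ e ∧ e + i ≤ N))), add_zero]
      · apply Finset.sum_congr rfl
        intro i hi
        rw [S.phi_pow s Φ hΦ (Submodule.smul_mem _ (c i) (hw' i hi).1), hx, map_smul,
          Pi.smul_apply, smul_eq_mul, ← mul_assoc, mul_inv_cancel₀ (hc i hi), one_mul]
      · intro i hi
        rw [Finset.mem_filter] at hi
        exact S.phi_vanish s Φ hΦ (hw i hi.1) x (by rw [hx]; exact hi.2)
  have h2 := S.layer_indep e I' (fun i hi => (Finset.mem_filter.mp hi).2) (fun i => c i • w i)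
    (fun i hi => Submodule.smul_mem _ _ (hw' i hi)) h1
  intro i hi hie
  have hi' : i ∈ I' := Finset.mem_filter.mpr ⟨hi, hie⟩
  rcases smul_eq_zero.mp (h2 i hi') with h | h
  · exact absurd h (inv_ne_zero (hc i hi'))
  · exact h

/-- the span of the string functions -/
def Cs (d : ℕ) : Submodule ℝ (X → ℝ) :=
  Submodule.span ℝ {f | ∃ i m : ℕ, i + m ≤ d ∧ ∃ h ∈ S.H i, f = fun x => (s x : ℝ) ^ m * Φ h x}

lemma Cs_mono {d d' : ℕ} (h : d ≤ d') : S.Cs s Φ d ≤ S.Cs s Φ d' := by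
  apply Submodule.span_mono
  rintro f ⟨i, m, h1, h2⟩
  exact ⟨i, m, by omega, h2⟩

lemma Cs_mul {d : ℕ} {f : X → ℝ} (hf : f ∈ S.Cs s Φ d) :
    (fun x => (s x : ℝ) * f x) ∈ S.Cs s Φ (d+1) := by
  induction hf using Submodule.span_induction with
  | mem f hf =>
    obtain ⟨i, m, h1, h, hh, rfl⟩ := hf
    apply Submodule.subset_span
    exact ⟨i, m+1, by omega, h, hh, by funext x; ring⟩
  | zero =>
    simp only [Pi.zero_apply, map_zero, mul_zero]
    exact Submodule.zero_mem _
  | add f g _ _ hf hg =>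
    convert Submodule.add_mem _ hf hg using 1
    funext x; simp [mul_add]
  | smul c f _ hf =>
    convert Submodule.smul_mem _ c hf using 1
    funext x; simp; ring

lemma phi_mem_Cs [FiniteDimensional ℝ V]
    (hΦ : ∀ i v, v ∈ S.L i → ∀ x, Φ (S.U v) x = ((s x : ℝ) - i) * Φ v x)
    (d : ℕ) (v : V) (hv : v ∈ S.L d) : Φ v ∈ S.Cs s Φ d := by
  have hH : ∀ d, ∀ h ∈ S.H d, Φ h ∈ S.Cs s Φ d := by
    intro d h hh
    apply Submodule.subset_span
    exact ⟨d, 0, by omega, h, hh, by funext x; simp⟩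
  induction d generalizing v with
  | zero => exact hH 0 v ⟨hv, S.hD0 v hv⟩
  | succ d ih =>
    obtain ⟨h, hh, u, hu, rfl⟩ := S.decomp hv
    rw [map_add]
    apply Submodule.add_mem _ (hH _ h hh)
    have e : Φ (S.U u) = (fun x => (s x : ℝ) * Φ u x) - (d:ℝ) • Φ u := by
      funext x
      rw [hΦ d u hu x]
      simp; ring
    rw [e]
    exact Submodule.sub_mem _ (S.Cs_mul s Φ (ih u hu))
      (Submodule.smul_mem _ _ (S.Cs_mono s Φ (Nat.le_succ d) (ih u hu)))

/-- vectors supported on layers up to `d` -/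
def Lle (d : ℕ) : Submodule ℝ V := ⨆ i : Fin (d+1), S.L i

lemma L_le_Lle {i d : ℕ} (h : i ≤ d) : S.L i ≤ S.Lle d :=
  le_iSup (fun i : Fin (d+1) => S.L i) ⟨i, by omega⟩

lemma A_mul (hΦ : ∀ i v, v ∈ S.L i → ∀ x, Φ (S.U v) x = ((s x : ℝ) - i) * Φ v x)
    {d : ℕ} {v : V} (hv : v ∈ S.Lle d) :
    (fun x => (s x : ℝ) * Φ v x) ∈ (S.Lle (d+1)).map Φ := by
  unfold Lle at hv
  induction hv using Submodule.iSup_induction' with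
  | mem i v hv =>
    refine ⟨S.U v + (i:ℝ) • v, ?_, ?_⟩
    · exact Submodule.add_mem _ (S.L_le_Lle (by omega) (S.hU _ _ hv))
        (Submodule.smul_mem _ _ (S.L_le_Lle (by omega) hv))
    · funext x
      rw [map_add, Pi.add_apply, hΦ _ _ hv, map_smul, Pi.smul_apply, smul_eq_mul]
      ring
  | zero =>
    simp only [Pi.zero_apply, map_zero, mul_zero]
    exact Submodule.zero_mem _
  | add v w _ _ hv hw =>
    convert Submodule.add_mem _ hv hw using 1
    funext x; simp [mul_add]

lemma map_eq_Cs [FiniteDimensional ℝ V]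
    (hΦ : ∀ i v, v ∈ S.L i → ∀ x, Φ (S.U v) x = ((s x : ℝ) - i) * Φ v x) (d : ℕ) :
    (S.Lle d).map Φ = S.Cs s Φ d := by
  apply le_antisymm
  · rw [Lle, Submodule.map_iSup, iSup_le_iff]
    rintro i f ⟨v, hv, rfl⟩
    exact S.Cs_mono s Φ (by omega) (S.phi_mem_Cs s Φ hΦ i v hv)
  · rw [Cs, Submodule.span_le]
    rintro f ⟨i, m, him, h, hh, rfl⟩
    have : ∀ m, (fun x => (s x : ℝ) ^ m * Φ h x) ∈ (S.Lle (i + m)).map Φ := by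
      intro m
      induction m with
      | zero =>
        refine ⟨h, S.L_le_Lle (by omega) hh.1, by funext x; simp⟩
      | succ m ih =>
        obtain ⟨v, hv, e⟩ := ih
        have := S.A_mul s Φ hΦ hv
        rw [e] at this
        have e2 : (fun x => (s x : ℝ) ^ (m+1) * Φ h x) =
            (fun x => (s x : ℝ) * (fun x => (s x : ℝ) ^ m * Φ h x) x) := by
          funext x; ring
        rw [e2]
        exact this
    refine Submodule.map_mono ?_ (this m)
    apply iSup_le
    intro j
    exact S.L_le_Lle (by omega)

theorem finrank_main [FiniteDimensional ℝ V]
    (hΦ : ∀ i v, v ∈ S.L i → ∀ x, Φ (S.U v) x = ((s x : ℝ) - i) * Φ v x)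
    (E : Finset ℕ) (hsE : ∀ x, s x ∈ E)
    (hΦ2 : ∀ e ∈ E, ∀ v ∈ S.L e, (∀ x, s x = e → Φ v x = 0) → v = 0) (d : ℕ) :
    Module.finrank ℝ ((S.Lle d).map Φ) =
      ∑ i ∈ Finset.range (N+1), Module.finrank ℝ (S.H i) *
        min (d + 1 - i) (E.filter (fun e => i ≤ e ∧ e + i ≤ N)).card := by
  rw [S.map_eq_Cs s Φ hΦ]
  set Ei : ℕ → Finset ℕ := fun i => E.filter (fun e => i ≤ e ∧ e + i ≤ N) with hEi
  let R : ℕ → ℕ := fun i => min (d + 1 - i) (Ei i).card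
  let β := fun i => Module.finBasis ℝ (S.H i)
  let J := (i : Fin (N+1)) × (Fin (Module.finrank ℝ (S.H i)) × Fin (R i))
  let b : J → (X → ℝ) := fun j => fun x => (s x : ℝ) ^ (j.2.2 : ℕ) * Φ (β j.1 j.2.1 : V) x
  have hspan : S.Cs s Φ d = Submodule.span ℝ (Set.range b) := by
    apply le_antisymm
    · rw [Cs, Submodule.span_le]
      rintro f ⟨i, m, him, h, hh, rfl⟩
      by_cases hiN : N < i
      · have : h = 0 := by simpa using S.vanish hh 0 (by omega)
        subst this
        simp only [Pi.zero_apply, map_zero, mul_zero]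
        exact Submodule.zero_mem _
      · obtain ⟨q, hq1, hq2⟩ : ∃ q : Polynomial ℝ, q.degree < (R i : ℕ) ∧
            ∀ e ∈ Ei i, q.eval (e:ℝ) = (e:ℝ) ^ m := by
          by_cases hm : m < R i
          · refine ⟨Polynomial.X ^ m, ?_, by simp⟩
            rw [Polynomial.degree_X_pow]
            exact_mod_cast hm
          · have hR : R i = (Ei i).card := by
              simp only [R] at hm ⊢
              omega
            have hinj : Set.InjOn (fun e : ℕ => (e:ℝ)) (Ei i) := fun a _ b _ h => Nat.cast_injective h
            refine ⟨Lagrange.interpolate (Ei i) (fun e : ℕ => (e:ℝ)) (fun e => (e:ℝ)^m), ?_, ?_⟩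
            · rw [hR]
              exact Lagrange.degree_interpolate_lt _ hinj
            · intro e he
              exact Lagrange.eval_interpolate_at_node _ hinj he
        have e1 : (fun x => (s x : ℝ) ^ m * Φ h x) = fun x => q.eval (s x : ℝ) * Φ h x := by
          funext x
          by_cases hx : i ≤ s x ∧ s x + i ≤ N
          · rw [hq2 (s x) (Finset.mem_filter.mpr ⟨hsE x, hx⟩)]
          · rw [S.phi_vanish s Φ hΦ hh x hx]; simp
        have e2 : h = ∑ c, (β i).repr ⟨h, hh⟩ c • (β i c : V) := by
          have := congrArg Subtype.val ((β i).sum_repr ⟨h, hh⟩)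
          rw [AddSubmonoidClass.coe_finsetSum] at this
          exact this.symm
        have e3 : (fun x => q.eval (s x : ℝ) * Φ h x) =
            ∑ c, ∑ m : Fin (R i), ((β i).repr ⟨h, hh⟩ c * q.coeff m) •
              b ⟨⟨i, by omega⟩, (c, m)⟩ := by
          have hΦh : Φ h = ∑ c, (β i).repr ⟨h, hh⟩ c • Φ (β i c : V) := by
            conv_lhs => rw [e2]
            simp
          funext x
          rw [hΦh]
          simp only [Finset.sum_apply, Pi.smul_apply, smul_eq_mul, b]
          rw [Finset.mul_sum]
          apply Finset.sum_congr rfl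
          intro c _
          have : q.eval (s x : ℝ) = ∑ m : Fin (R i), q.coeff m * (s x : ℝ) ^ (m:ℕ) := by
            rw [Polynomial.eval_eq_sum_degreeLTEquiv (Polynomial.mem_degreeLT.mpr hq1)]
            rfl
          rw [this, Finset.sum_mul]
          apply Finset.sum_congr rfl
          intro m _
          ring
        rw [SetLike.mem_coe, e1, e3]
        exact Submodule.sum_mem _ fun c _ => Submodule.sum_mem _ fun m _ =>
          Submodule.smul_mem _ _ (Submodule.subset_span ⟨_, rfl⟩)
    · rw [Submodule.span_le]
      rintro f ⟨⟨i, c, m⟩, rfl⟩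
      apply Submodule.subset_span
      have := m.2
      refine ⟨i, m, ?_, (β i c : V), (β i c).2, rfl⟩
      have h2 : (m:ℕ) < d + 1 - i := lt_of_lt_of_le m.2 (min_le_left _ _)
      omega
  have hind : LinearIndependent ℝ b := by
    rw [Fintype.linearIndependent_iff]
    intro g hg
    have hz : ∀ (i : Fin (N+1)) (c : Fin (Module.finrank ℝ (S.H i))), ∀ e ∈ Ei i,
        ∑ m : Fin (R i), g ⟨i, (c, m)⟩ * (e:ℝ) ^ (m:ℕ) = 0 := by
      intro i c e he
      obtain ⟨heE, hei⟩ := Finset.mem_filter.mp he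
      let w : ℕ → V := fun i => if hi : i < N + 1 then
        ∑ c, (∑ m : Fin (R i), g ⟨⟨i, hi⟩, (c, m)⟩ * (e:ℝ) ^ (m:ℕ)) • (β i c : V) else 0
      have hw : ∀ i ∈ Finset.range (N+1), w i ∈ S.H i := by
        intro i hi
        simp only [w, dif_pos (Finset.mem_range.mp hi)]
        exact Submodule.sum_mem _ fun c _ => Submodule.smul_mem _ _ (β i c).2
      have h0 : ∀ x, s x = e → ∑ i ∈ Finset.range (N+1), Φ (w i) x = 0 := by
        intro x hx
        have := congrFun hg x
        rw [Finset.sum_apply, Fintype.sum_sigma] at this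
        rw [Finset.sum_range, ← Pi.zero_apply (M := fun _ => ℝ) x, ← this]
        apply Finset.sum_congr rfl
        intro i _
        simp only [w, dif_pos i.2]
        rw [Fintype.sum_prod_type, map_sum, Finset.sum_apply]
        apply Finset.sum_congr rfl
        intro c _
        rw [map_smul, Pi.smul_apply, smul_eq_mul, Finset.sum_mul]
        apply Finset.sum_congr rfl
        intro m _
        simp only [b, Pi.smul_apply, smul_eq_mul, hx]
        ring
      have h1 := S.phi_indep s Φ hΦ e (hΦ2 e heE) _ w hw h0 i (Finset.mem_range.mpr i.2) hei
      simp only [w, dif_pos i.2] at h1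
      have h2 := Fintype.linearIndependent_iff.mp (β i).linearIndependent
        (fun c => ∑ m : Fin (R i), g ⟨i, (c, m)⟩ * (e:ℝ) ^ (m:ℕ)) (by
          apply Subtype.ext
          simpa using h1)
      exact h2 c
    rintro ⟨i, c, m⟩
    let q : Polynomial ℝ := ∑ m : Fin (R i), Polynomial.monomial (m:ℕ) (g ⟨i, (c, m)⟩)
    have hq0 : q = 0 := by
      by_contra hne
      have hdeg : q.degree < (R i : ℕ) := by
        apply Polynomial.mem_degreeLT.mp
        apply Submodule.sum_mem
        intro m _
        apply Polynomial.mem_degreeLT.mpr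
        exact lt_of_le_of_lt (Polynomial.degree_monomial_le _ _) (by exact_mod_cast m.2)
      have hnd : q.natDegree < R i := (Polynomial.natDegree_lt_iff_degree_lt hne).mpr hdeg
      apply hne
      apply Polynomial.eq_zero_of_natDegree_lt_card_of_eval_eq_zero' q
        ((Ei i).image (fun e : ℕ => (e:ℝ)))
      · intro r hr
        obtain ⟨e, he, rfl⟩ := Finset.mem_image.mp hr
        rw [Polynomial.eval_finsetSum]
        simpa using hz i c e he
      · rw [Finset.card_image_of_injective _ Nat.cast_injective]
        exact lt_of_lt_of_le hnd (min_le_right _ _)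
    have : q.coeff m = g ⟨i, (c, m)⟩ := by
      simp only [q, Polynomial.finsetSum_coeff, Polynomial.coeff_monomial]
      rw [Finset.sum_eq_single m]
      · simp
      · intro m' _ hne
        rw [if_neg]
        intro h
        exact hne (Fin.ext h)
      · simp
    rw [← this, hq0, Polynomial.coeff_zero]
  rw [hspan, finrank_span_eq_card hind, Fintype.card_sigma, Finset.sum_range]
  apply Finset.sum_congr rfl
  intro i _
  rw [Fintype.card_prod, Fintype.card_fin, Fintype.card_fin]

end LData
noncomputable section

section concrete

variable {n : ℕ} (k : Fin n → ℕ)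

/-- grid of natural vectors -/
def gr (b : Fin n → ℕ) : Prop := ∀ i, b i < k i

def gridF : Finset (Fin n → ℕ) := Fintype.piFinset fun i => Finset.range (k i)

lemma mem_gridF {b : Fin n → ℕ} : b ∈ gridF k ↔ gr k b := by
  simp [gridF, gr, Fintype.mem_piFinset]

def up (b : Fin n → ℕ) (i : Fin n) : Fin n → ℕ := Function.update b i (b i + 1)
def dn (b : Fin n → ℕ) (i : Fin n) : Fin n → ℕ := Function.update b i (b i - 1)

lemma up_same (b : Fin n → ℕ) (i : Fin n) : up b i i = b i + 1 := by simp [up]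
lemma dn_same (b : Fin n → ℕ) (i : Fin n) : dn b i i = b i - 1 := by simp [dn]
lemma up_ne (b : Fin n → ℕ) {i j : Fin n} (h : j ≠ i) : up b i j = b j := by simp [up, h]
lemma dn_ne (b : Fin n → ℕ) {i j : Fin n} (h : j ≠ i) : dn b i j = b j := by simp [dn, h]

lemma dn_up (b : Fin n → ℕ) (i : Fin n) : dn (up b i) i = b := by
  funext j
  by_cases h : j = i
  · subst h; rw [dn_same, up_same]; rfl
  · rw [dn_ne _ h, up_ne _ h]

lemma up_dn (b : Fin n → ℕ) (i : Fin n) (hb : b i ≠ 0) : up (dn b i) i = b := by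
  funext j
  by_cases h : j = i
  · subst h; rw [up_same, dn_same]; omega
  · rw [up_ne _ h, dn_ne _ h]

lemma up_dn_comm (b : Fin n → ℕ) {i j : Fin n} (h : i ≠ j) : dn (up b i) j = up (dn b j) i := by
  funext l
  by_cases h1 : l = i
  · subst h1; rw [dn_ne _ h, up_same, up_same, dn_ne _ h]
  · by_cases h2 : l = j
    · subst h2; rw [dn_same, up_ne _ h1, up_ne _ h1, dn_same]
    · rw [dn_ne _ h2, up_ne _ h1, up_ne _ h1, dn_ne _ h2]

lemma wt_up (b : Fin n → ℕ) (i : Fin n) : ∑ j, up b i j = ∑ j, b j + 1 := by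
  rw [← Finset.add_sum_erase _ _ (Finset.mem_univ i),
    ← Finset.add_sum_erase _ b (Finset.mem_univ i), up_same]
  rw [Finset.sum_congr rfl (fun j hj => up_ne b (Finset.ne_of_mem_erase hj))]
  omega

lemma wt_dn (b : Fin n → ℕ) (i : Fin n) (hb : b i ≠ 0) : ∑ j, dn b i j + 1 = ∑ j, b j := by
  rw [← wt_up _ i, up_dn b i hb]

lemma prod_up (f : Fin n → ℕ → ℝ) (a : Fin n → ℕ) (i : Fin n) (c c' : ℝ)
    (h : c * f i (a i + 1) = c' * f i (a i)) :
    c * ∏ j, f j (up a i j) = c' * ∏ j, f j (a j) := by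
  rw [← Finset.mul_prod_erase _ _ (Finset.mem_univ i),
    ← Finset.mul_prod_erase _ (fun j => f j (a j)) (Finset.mem_univ i), up_same]
  rw [Finset.prod_congr rfl (fun j hj => by rw [up_ne a (Finset.ne_of_mem_erase hj)])]
  rw [← mul_assoc, h, mul_assoc]

/-- functions supported on the grid -/
def MG : Submodule ℝ ((Fin n → ℕ) → ℝ) where
  carrier := {v | ∀ b, ¬ gr k b → v b = 0}
  zero_mem' := by intro b _; rfl
  add_mem' := by intro v w hv hw b hb; simp [hv b hb, hw b hb]
  smul_mem' := by intro c v hv b hb; simp [hv b hb]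

instance : FiniteDimensional ℝ (MG k) := by
  let f : MG k →ₗ[ℝ] (gridF k → ℝ) :=
    { toFun := fun v b => v.1 b.1
      map_add' := fun v w => rfl
      map_smul' := fun c v => rfl }
  apply FiniteDimensional.of_injective f
  intro v w h
  apply Subtype.ext
  funext b
  by_cases hb : gr k b
  · exact congrFun h ⟨b, (mem_gridF k).mpr hb⟩
  · rw [v.2 b hb, w.2 b hb]

def Ui (i : Fin n) : MG k →ₗ[ℝ] MG k where
  toFun v := ⟨fun b => (b i : ℝ) * (k i - b i) * v.1 (dn b i), by
    intro b hb
    by_cases h0 : b i = 0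
    · simp [h0]
    by_cases h1 : b i = k i
    · simp [h1]
    have : ¬ gr k (dn b i) := by
      intro h
      apply hb
      intro j
      have hj := h j
      by_cases hji : j = i
      · subst hji; rw [dn_same] at hj; omega
      · rwa [dn_ne _ hji] at hj
    simp [v.2 _ this]⟩
  map_add' v w := by
    apply Subtype.ext; funext b; simp; ring
  map_smul' c v := by
    apply Subtype.ext; funext b; simp; ring

def Ug : MG k →ₗ[ℝ] MG k := ∑ i, Ui k i

lemma Ug_apply (v : MG k) (b : Fin n → ℕ) :
    (Ug k v).1 b = ∑ i, (b i : ℝ) * (k i - b i) * v.1 (dn b i) := by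
  simp [Ug, Ui]

lemma not_gr_up {b : Fin n → ℕ} (hb : ¬ gr k b) (i : Fin n) : ¬ gr k (up b i) := by
  intro h
  apply hb
  intro j
  have hj := h j
  by_cases hji : j = i
  · subst hji; rw [up_same] at hj; omega
  · rwa [up_ne _ hji] at hj

def Dg : MG k →ₗ[ℝ] MG k where
  toFun v := ⟨fun b => ∑ i, v.1 (up b i), by
    intro b hb
    exact Finset.sum_eq_zero fun i _ => v.2 _ (not_gr_up k hb i)⟩
  map_add' v w := by
    apply Subtype.ext; funext b; simp [Finset.sum_add_distrib]
  map_smul' c v := by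
    apply Subtype.ext; funext b; simp [Finset.mul_sum]

lemma Dg_apply (v : MG k) (b : Fin n → ℕ) : (Dg k v).1 b = ∑ i, v.1 (up b i) := rfl

lemma comm_apply (v : MG k) (b : Fin n → ℕ) :
    (Dg k (Ug k v)).1 b = (Ug k (Dg k v)).1 b +
      (∑ i, ((k i : ℝ) - 1 - 2 * b i)) * v.1 b := by
  rw [Dg_apply, Ug_apply]
  simp only [Ug_apply, Dg_apply, Finset.mul_sum]
  rw [Finset.sum_comm, Finset.sum_mul, ← Finset.sum_add_distrib]
  apply Finset.sum_congr rfl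
  intro j _
  rw [← Finset.add_sum_erase _ _ (Finset.mem_univ j)]
  conv_rhs => rw [← Finset.add_sum_erase _ _ (Finset.mem_univ j)]
  rw [Finset.sum_congr rfl (g := fun i => (b j : ℝ) * (k j - b j) * v.1 (up (dn b j) i))]
  · rw [dn_up, up_same]
    by_cases h0 : b j = 0
    · simp [h0]
    · rw [up_dn b j h0]; push_cast; ring
  · intro i hi
    have hij := Finset.ne_of_mem_erase hi
    rw [up_dn_comm b hij, up_ne _ hij.symm]

def Lg (d : ℕ) : Submodule ℝ (MG k) where
  carrier := {v | ∀ b, ∑ i, b i ≠ d → v.1 b = 0}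
  zero_mem' := by intro b _; rfl
  add_mem' := by intro v w hv hw b hb; simp [hv b hb, hw b hb]
  smul_mem' := by intro c v hv b hb; simp [hv b hb]

lemma Ui_mem (i : Fin n) (d : ℕ) (v : MG k) (hv : v ∈ Lg k d) : Ui k i v ∈ Lg k (d+1) := by
  intro b hb
  change (b i : ℝ) * (k i - b i) * v.1 (dn b i) = 0
  by_cases h0 : b i = 0
  · simp [h0]
  · rw [hv (dn b i), mul_zero]
    have := wt_dn b i h0
    omega

lemma reindex (v w : (Fin n → ℕ) → ℝ) (i : Fin n) :
    ∑ b ∈ gridF k, (b i : ℝ) * (k i - b i) * v (dn b i) * w b =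
    ∑ a ∈ gridF k, ((a i : ℝ) + 1) * (k i - 1 - a i) * v a * w (up a i) := by
  rw [← Finset.sum_filter_of_ne (s := gridF k) (p := fun b => b i ≠ 0)]
  · rw [← Finset.sum_filter_of_ne (s := gridF k) (p := fun a => a i + 1 < k i)]
    · refine Finset.sum_nbij' (fun b => dn b i) (fun a => up a i) ?_ ?_ ?_ ?_ ?_
      · intro b hb
        simp only [Finset.mem_filter, mem_gridF] at hb ⊢
        refine ⟨?_, ?_⟩
        · intro j
          have := hb.1 j
          by_cases hji : j = i
          · subst hji; rw [dn_same]; omega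
          · rwa [dn_ne _ hji]
        · have := hb.1 i
          rw [dn_same]; omega
      · intro a ha
        simp only [Finset.mem_filter, mem_gridF] at ha ⊢
        refine ⟨?_, ?_⟩
        · intro j
          have := ha.1 j
          by_cases hji : j = i
          · subst hji; rw [up_same]; omega
          · rwa [up_ne _ hji]
        · rw [up_same]; omega
      · intro b hb
        exact up_dn b i (Finset.mem_filter.mp hb).2
      · intro a _
        exact dn_up a i
      · intro b hb
        have h0 := (Finset.mem_filter.mp hb).2
        simp only [up_dn b i h0, dn_same]
        rw [Nat.cast_sub (by omega)]
        push_cast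
        ring
    · intro a ha hne
      have h1 := (mem_gridF k).mp ha i
      by_contra h2
      apply hne
      have : k i = a i + 1 := by omega
      rw [this]; push_cast; ring
  · intro b _ hne h0
    apply hne
    simp [h0]

def omg (a : Fin n → ℕ) : ℝ := ∏ i, ((k i - 1 - a i).factorial : ℝ) / (a i).factorial

lemma omg_pos (a : Fin n → ℕ) : 0 < omg k a := by
  unfold omg; positivity

lemma omg_up (a : Fin n → ℕ) (i : Fin n) (h : a i + 1 < k i) :
    ((a i : ℝ) + 1) * (k i - 1 - a i) * omg k (up a i) = omg k a := by
  have := prod_up (fun i t => ((k i - 1 - t).factorial : ℝ) / t.factorial) a i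
    (((a i : ℝ) + 1) * (k i - 1 - a i)) 1 (by
      obtain ⟨m, hm⟩ : ∃ m, k i = a i + 2 + m := ⟨k i - (a i + 2), by omega⟩
      have e1 : k i - 1 - a i = m + 1 := by omega
      have e2 : k i - 1 - (a i + 1) = m := by omega
      have hR : (k i : ℝ) = a i + 2 + m := by rw [hm]; push_cast; ring
      simp only [e1, e2, Nat.factorial_succ]
      rw [hR]
      push_cast
      have : ((a i).factorial : ℝ) ≠ 0 := by positivity
      have : (a i : ℝ) + 1 ≠ 0 := by positivity
      field_simp
      ring)
  rw [one_mul] at this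
  exact this

def Bg : LinearMap.BilinForm ℝ (MG k) :=
  LinearMap.mk₂ ℝ (fun v w => ∑ a ∈ gridF k, omg k a * v.1 a * w.1 a)
    (by intro u v w; rw [← Finset.sum_add_distrib]; apply Finset.sum_congr rfl
        intro a _; simp; ring)
    (by intro c v w; rw [Finset.smul_sum]; apply Finset.sum_congr rfl
        intro a _; simp; ring)
    (by intro u v w; rw [← Finset.sum_add_distrib]; apply Finset.sum_congr rfl
        intro a _; simp; ring)
    (by intro c v w; rw [Finset.smul_sum]; apply Finset.sum_congr rfl
        intro a _; simp; ring)

lemma Bg_apply (v w : MG k) : Bg k v w = ∑ a ∈ gridF k, omg k a * v.1 a * w.1 a := rfl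

lemma Bg_adj (v w : MG k) : Bg k (Ug k v) w = Bg k v (Dg k w) := by
  rw [Bg_apply, Bg_apply]
  simp only [Ug_apply, Dg_apply, Finset.mul_sum, Finset.sum_mul]
  rw [Finset.sum_comm]
  conv_rhs => rw [Finset.sum_comm]
  apply Finset.sum_congr rfl
  intro i _
  have := reindex k v.1 (fun b => omg k b * w.1 b) i
  rw [Finset.sum_congr rfl (g := fun b => (b i : ℝ) * (k i - b i) * v.1 (dn b i) *
    (omg k b * w.1 b)) (by intro b _; ring), this]
  apply Finset.sum_congr rfl
  intro a ha
  have h1 := (mem_gridF k).mp ha i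
  by_cases h2 : a i + 1 < k i
  · rw [← omg_up k a i h2]; ring
  · have : ¬ gr k (up a i) := by
      intro h; have := h i; rw [up_same] at this; omega
    rw [w.2 _ this]; ring

def SG (hk : ∀ i, 2 ≤ k i) (N : ℕ) (hN : N = ∑ i, (k i - 1)) : LData (MG k) N where
  U := Ug k
  D := Dg k
  L := Lg k
  B := Bg k
  hU := by
    intro d v hv
    unfold Ug
    rw [LinearMap.sum_apply]
    exact Submodule.sum_mem _ fun i _ => Ui_mem k i d v hv
  hD := by
    intro d v hv b hb
    rw [Dg_apply]
    apply Finset.sum_eq_zero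
    intro i _
    apply hv
    rw [wt_up]
    omega
  hD0 := by
    intro v hv
    apply Subtype.ext
    funext b
    rw [Dg_apply]
    apply Finset.sum_eq_zero
    intro i _
    apply hv
    rw [wt_up]
    omega
  comm := by
    intro d v hv
    apply Subtype.ext
    funext b
    rw [comm_apply]
    change _ = (Ug k (Dg k v)).1 b + ((N:ℝ) - 2 * d) * v.1 b
    congr 1
    by_cases hb : ∑ i, b i = d
    · congr 1
      rw [← hb, hN, Finset.sum_sub_distrib, ← Finset.mul_sum]
      push_cast
      congr 1
      apply Finset.sum_congr rfl
      intro i _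
      rw [Nat.cast_sub (by have := hk i; omega)]
      simp
    · rw [hv b hb]; simp
  symm := by
    intro v w
    rw [Bg_apply, Bg_apply]
    apply Finset.sum_congr rfl
    intro a _; ring
  pos := by
    intro v hv
    rw [Bg_apply]
    have hnn : ∀ a ∈ gridF k, 0 ≤ omg k a * v.1 a * v.1 a := by
      intro a _
      rw [mul_assoc]
      exact mul_nonneg (omg_pos k a).le (mul_self_nonneg _)
    apply lt_of_le_of_ne (Finset.sum_nonneg hnn)
    intro h0
    apply hv
    have := (Finset.sum_eq_zero_iff_of_nonneg hnn).mp h0.symm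
    apply Subtype.ext
    funext b
    by_cases hb : gr k b
    · have := this b ((mem_gridF k).mpr hb)
      rw [mul_assoc] at this
      rcases mul_eq_zero.mp this with h | h
      · exact absurd h (omg_pos k b).ne'
      · exact mul_self_eq_zero.mp h
    · exact v.2 b hb
  adj := Bg_adj k

/-- binomial-type basis functions -/
def pf (a x : Fin n → ℕ) : ℝ := ∏ i, ((k i - 1 - a i).factorial : ℝ) * ((x i).choose (a i))

lemma pf_up (a x : Fin n → ℕ) (ha : gr k a) (hx : gr k x) (i : Fin n) :
    ((a i : ℝ) + 1) * (k i - 1 - a i) * pf k (up a i) x = ((x i : ℝ) - a i) * pf k a x := by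
  refine prod_up (fun i t => ((k i - 1 - t).factorial : ℝ) * ((x i).choose t)) a i _ _ ?_
  have h1 := ha i
  have h2 := hx i
  have hc : ((x i).choose (a i + 1) : ℝ) * (a i + 1) = (x i).choose (a i) * ((x i : ℝ) - a i) := by
    by_cases h : a i ≤ x i
    · have := Nat.choose_succ_right_eq (x i) (a i)
      have h3 : (((x i).choose (a i + 1) * (a i + 1) : ℕ) : ℝ) =
        (((x i).choose (a i) * (x i - a i) : ℕ) : ℝ) := by rw [this]
      push_cast [Nat.cast_sub h] at h3
      exact h3
    · rw [Nat.choose_eq_zero_of_lt (by omega), Nat.choose_eq_zero_of_lt (by omega)]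
      simp
  by_cases h3 : a i + 1 < k i
  · obtain ⟨m, hm⟩ : ∃ m, k i = a i + 2 + m := ⟨k i - (a i + 2), by omega⟩
    have e1 : k i - 1 - a i = m + 1 := by omega
    have e2 : k i - 1 - (a i + 1) = m := by omega
    have hR : (k i : ℝ) = a i + 2 + m := by rw [hm]; push_cast; ring
    simp only [e1, e2, Nat.factorial_succ]
    rw [hR]
    push_cast
    linear_combination ((m:ℝ)+1) * m.factorial * hc
  · have h4 : k i = a i + 1 := by omega
    have h5 : (x i).choose (a i + 1) = 0 := Nat.choose_eq_zero_of_lt (by omega)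
    rw [h5] at hc
    rw [h5]
    push_cast at hc ⊢
    linear_combination ((k i - 1 - a i).factorial : ℝ) * hc

lemma pf_self_ne (a : Fin n → ℕ) : pf k a a ≠ 0 := by
  unfold pf
  simp only [Nat.choose_self]
  positivity

lemma pf_off (a x : Fin n → ℕ) (h : ∑ i, a i = ∑ i, x i) (hne : a ≠ x) : pf k a x = 0 := by
  by_contra hp
  apply hne
  have hle : ∀ i ∈ Finset.univ, a i ≤ x i := by
    intro i _
    by_contra hlt
    apply hp
    apply Finset.prod_eq_zero (Finset.mem_univ i)
    rw [Nat.choose_eq_zero_of_lt (by omega)]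
    simp
  funext i
  exact (Finset.sum_eq_sum_iff_of_le hle).mp h i (Finset.mem_univ i)

def nv (x : Fin n → ℝ) : Fin n → ℕ := fun i => ⌊x i⌋₊

lemma nv_cast (b : Fin n → ℕ) : nv (fun i => (b i : ℝ)) = b := by
  funext i; simp [nv]

lemma cast_nv {x : Fin n → ℝ} (hx : x ∈ gridSetR n k) : (fun i => (nv x i : ℝ)) = x := by
  funext i
  obtain ⟨a, _, h⟩ := hx i
  simp [nv, h]

lemma gr_nv {x : Fin n → ℝ} (hx : x ∈ gridSetR n k) : gr k (nv x) := by
  intro i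
  obtain ⟨a, ha, h⟩ := hx i
  simpa [nv, h] using ha

lemma wt_nv {x : Fin n → ℝ} {E : Set ℕ} (hx : x ∈ underlineR n k E) : ∑ i, nv x i ∈ E := by
  obtain ⟨hg, e, he, h⟩ := hx
  have : ((∑ i, nv x i : ℕ) : ℝ) = e := by
    rw [← h]
    push_cast
    exact Finset.sum_congr rfl fun i _ => congrFun (cast_nv k hg) i
  have : ∑ i, nv x i = e := by exact_mod_cast this
  rwa [this]

lemma cast_mem {b : Fin n → ℕ} {E : Set ℕ} (hb : gr k b) (he : ∑ i, b i ∈ E) :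
    (fun i => (b i : ℝ)) ∈ underlineR n k E :=
  ⟨fun i => ⟨b i, hb i, rfl⟩, _, he, by push_cast; rfl⟩

variable (E : Set ℕ)

def Phi : MG k →ₗ[ℝ] (underlineR n k E → ℝ) where
  toFun v := fun x => ∑ a ∈ gridF k, v.1 a * pf k a (nv x.1)
  map_add' v w := by
    funext x
    simp [add_mul, Finset.sum_add_distrib]
  map_smul' c v := by
    funext x
    simp [Finset.mul_sum, mul_assoc]

lemma Phi_apply (v : MG k) (x : underlineR n k E) :
    Phi k E v x = ∑ a ∈ gridF k, v.1 a * pf k a (nv x.1) := rfl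

lemma Phi_Ui (i : Fin n) (v : MG k) (x : underlineR n k E) :
    Phi k E (Ui k i v) x = ∑ a ∈ gridF k, ((nv x.1 i : ℝ) - a i) * (v.1 a * pf k a (nv x.1)) := by
  rw [Phi_apply]
  have := reindex k v.1 (fun b => pf k b (nv x.1)) i
  refine Eq.trans (Eq.trans ?_ this) ?_
  · rfl
  · apply Finset.sum_congr rfl
    intro a ha
    have := pf_up k a (nv x.1) ((mem_gridF k).mp ha) (gr_nv k x.2.1) i
    linear_combination v.1 a * this

lemma Phi_U (d : ℕ) (v : MG k) (hv : v ∈ Lg k d) (x : underlineR n k E) :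
    Phi k E (Ug k v) x = (((∑ i, nv x.1 i : ℕ) : ℝ) - d) * Phi k E v x := by
  unfold Ug
  rw [LinearMap.sum_apply, map_sum, Finset.sum_apply]
  simp only [Phi_Ui]
  rw [Finset.sum_comm, Phi_apply, Finset.mul_sum]
  apply Finset.sum_congr rfl
  intro a _
  rw [← Finset.sum_mul]
  by_cases ha : ∑ i, a i = d
  · rw [← ha, Finset.sum_sub_distrib]; push_cast; rfl
  · rw [hv a ha]; simp

lemma Phi_layer (v : MG k) (d : ℕ) (hv : v ∈ Lg k d) (x : underlineR n k E)
    (hx : ∑ i, nv x.1 i = d) : Phi k E v x = v.1 (nv x.1) * pf k (nv x.1) (nv x.1) := by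
  rw [Phi_apply]
  apply Finset.sum_eq_single
  · intro a _ hne
    by_cases ha : ∑ i, a i = d
    · rw [pf_off k a _ (by rw [ha, hx]) hne, mul_zero]
    · rw [hv a ha, zero_mul]
  · intro h
    exact absurd ((mem_gridF k).mpr (gr_nv k x.2.1)) h

lemma Phi_inj (e : ℕ) (he : e ∈ E) (v : MG k) (hv : v ∈ Lg k e)
    (h : ∀ x : underlineR n k E, ∑ i, nv x.1 i = e → Phi k E v x = 0) : v = 0 := by
  apply Subtype.ext
  funext b
  by_cases hb : gr k b
  · by_cases hw : ∑ i, b i = e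
    · have hm := cast_mem k (E := E) hb (by rw [hw]; exact he)
      have h1 := h ⟨_, hm⟩ (by simp only [nv_cast]; exact hw)
      rw [Phi_layer k E v e hv _ (by simp only [nv_cast]; exact hw)] at h1
      simp only [nv_cast] at h1
      exact (mul_eq_zero.mp h1).resolve_right (pf_self_ne k b)
    · exact hv b hw
  · exact v.2 b hb

/-- polynomial representing `pf` -/
def PP (a : Fin n → ℕ) : MvPolynomial (Fin n) ℝ :=
  ∏ i, (MvPolynomial.C (((k i - 1 - a i).factorial : ℝ) / (a i).factorial) *
    ∏ t ∈ Finset.range (a i), (MvPolynomial.X i - MvPolynomial.C (t : ℝ)))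

lemma PP_deg (a : Fin n → ℕ) : (PP k a).totalDegree ≤ ∑ i, a i := by
  unfold PP
  refine (MvPolynomial.totalDegree_finsetProd _ _).trans ?_
  apply Finset.sum_le_sum
  intro i _
  refine (MvPolynomial.totalDegree_mul _ _).trans ?_
  rw [MvPolynomial.totalDegree_C, zero_add]
  refine (MvPolynomial.totalDegree_finsetProd _ _).trans ?_
  refine (Finset.sum_le_card_nsmul _ _ 1 ?_).trans ?_
  · intro t _
    refine (MvPolynomial.totalDegree_sub_C_le _ _).trans ?_
    simp
  · simp

lemma PP_eval (a x : Fin n → ℕ) :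
    MvPolynomial.eval (fun i => (x i : ℝ)) (PP k a) = pf k a x := by
  unfold PP pf
  rw [map_prod]
  apply Finset.prod_congr rfl
  intro i _
  rw [map_mul, map_prod, MvPolynomial.eval_C]
  have h1 : ∏ t ∈ Finset.range (a i), MvPolynomial.eval (fun i => (x i : ℝ))
      (MvPolynomial.X i - MvPolynomial.C (t : ℝ)) = ((x i).descFactorial (a i) : ℝ) := by
    simp only [map_sub, MvPolynomial.eval_X, MvPolynomial.eval_C]
    rw [← descPochhammer_eval_eq_descFactorial, descPochhammer_eval_eq_prod_range]
  rw [h1, Nat.descFactorial_eq_factorial_mul_choose]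
  have : ((a i).factorial : ℝ) ≠ 0 := by positivity
  push_cast
  field_simp

lemma evalLM_apply (A : Set (Fin n → ℝ)) (p : MvPolynomial (Fin n) ℝ) (x : A) :
    evalLM n A p x = MvPolynomial.eval x.1 p := rfl

lemma Phi_eq_eval (v : MG k) :
    Phi k E v = evalLM n (underlineR n k E)
      (∑ a ∈ gridF k, MvPolynomial.C (v.1 a) * PP k a) := by
  funext x
  rw [Phi_apply, evalLM_apply, map_sum]
  apply Finset.sum_congr rfl
  intro a _
  rw [map_mul, MvPolynomial.eval_C, ← PP_eval, cast_nv k x.2.1]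

variable (hk : ∀ i, 2 ≤ k i) (N : ℕ) (hN : N = ∑ i, (k i - 1))

/-- multiplication by the i-th coordinate index -/
def Ci (i : Fin n) : MG k →ₗ[ℝ] MG k where
  toFun v := ⟨fun b => (b i : ℝ) * v.1 b, by
    intro b hb
    change (b i : ℝ) * v.1 b = 0
    rw [v.2 b hb, mul_zero]⟩
  map_add' v w := by
    apply Subtype.ext; funext b; simp; ring
  map_smul' c v := by
    apply Subtype.ext; funext b; simp; ring

lemma X_mul (i : Fin n) {d : ℕ} {v : MG k} (hv : v ∈ (SG k hk N hN).Lle d) :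
    (fun x : underlineR n k E => x.1 i * Phi k E v x) ∈
      ((SG k hk N hN).Lle (d+1)).map (Phi k E) := by
  unfold LData.Lle at hv
  induction hv using Submodule.iSup_induction' with
  | mem j v hv =>
    have hv : v ∈ Lg k j := hv
    have h1 : Ui k i v ∈ (SG k hk N hN).L (j+1) := Ui_mem k i j v hv
    have h2 : Ci k i v ∈ (SG k hk N hN).L j := by
      intro b hb
      change (b i : ℝ) * v.1 b = 0
      rw [hv b hb, mul_zero]
    refine ⟨Ui k i v + Ci k i v, ?_, ?_⟩
    · exact Submodule.add_mem _ ((SG k hk N hN).L_le_Lle (by omega) h1)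
        ((SG k hk N hN).L_le_Lle (by omega) h2)
    · funext x
      rw [map_add, Pi.add_apply, Phi_Ui, Phi_apply, Phi_apply, ← Finset.sum_add_distrib,
        Finset.mul_sum]
      apply Finset.sum_congr rfl
      intro a _
      change _ + ((a i : ℝ) * v.1 a) * _ = _
      have : (nv x.1 i : ℝ) = x.1 i := congrFun (cast_nv k x.2.1) i
      rw [this]
      ring
  | zero =>
    simp only [map_zero, Pi.zero_apply, mul_zero]
    exact Submodule.zero_mem _
  | add v w _ _ hv hw =>
    convert Submodule.add_mem _ hv hw using 1
    funext x; simp [mul_add]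

lemma monom_mem (m : ℕ) (σ : Fin n →₀ ℕ) (hσ : σ.degree = m) :
    evalLM n (underlineR n k E) (MvPolynomial.monomial σ 1) ∈
      ((SG k hk N hN).Lle m).map (Phi k E) := by
  induction m generalizing σ with
  | zero =>
    have : σ = 0 := (Finsupp.degree_eq_zero_iff _).mp hσ
    subst this
    let v : MG k := ⟨fun b => if b = 0 then (pf k 0 0)⁻¹ else 0, by
      intro b hb
      apply if_neg
      rintro rfl
      apply hb
      intro i
      have := hk i
      simp only [Pi.zero_apply]
      omega⟩
    have hv : v ∈ (SG k hk N hN).L 0 := by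
      intro b hb
      change (if b = 0 then (pf k 0 0)⁻¹ else 0) = 0
      rw [if_neg]
      rintro rfl
      simp at hb
    refine ⟨v, (SG k hk N hN).L_le_Lle le_rfl hv, ?_⟩
    funext x
    rw [Phi_apply, evalLM_apply, Finset.sum_eq_single 0]
    · change (if (0 : Fin n → ℕ) = 0 then (pf k 0 0)⁻¹ else 0) * _ = _
      rw [if_pos rfl]
      have : pf k 0 (nv x.1) = pf k 0 0 := by simp [pf]
      rw [this, inv_mul_cancel₀ (pf_self_ne k 0)]
      simp
    · intro a _ ha
      change (if a = 0 then (pf k 0 0)⁻¹ else 0) * _ = _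
      rw [if_neg ha, zero_mul]
    · intro h
      exfalso
      apply h
      rw [mem_gridF]
      intro i
      have := hk i
      simp only [Pi.zero_apply]
      omega
  | succ m ih =>
    have : σ ≠ 0 := by
      rintro rfl
      simp at hσ
    obtain ⟨i, hi⟩ := Finsupp.ne_iff.mp this
    have hle : Finsupp.single i 1 ≤ σ := by
      rw [Finsupp.single_le_iff]
      simp at hi
      omega
    obtain ⟨τ, rfl⟩ := exists_add_of_le hle
    have hτ : τ.degree = m := by
      rw [map_add, Finsupp.degree_single] at hσ
      omega
    obtain ⟨v, hv, e⟩ := ih τ hτ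
    have := X_mul k E hk N hN i hv
    rw [e] at this
    convert this using 1
    funext x
    simp only [evalLM_apply]
    rw [show MvPolynomial.monomial (Finsupp.single i 1 + τ) (1:ℝ) =
      MvPolynomial.X i * MvPolynomial.monomial τ 1 by
        rw [MvPolynomial.X, MvPolynomial.monomial_mul, one_mul]]
    rw [map_mul, MvPolynomial.eval_X]

lemma map_eval_eq (d : ℕ) :
    (MvPolynomial.restrictTotalDegree (Fin n) ℝ d).map (evalLM n (underlineR n k E)) =
      ((SG k hk N hN).Lle d).map (Phi k E) := by
  apply le_antisymm
  · rintro f ⟨p, hp, rfl⟩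
    have hp : p.totalDegree ≤ d := (MvPolynomial.mem_restrictTotalDegree _ _ _).mp hp
    rw [p.as_sum, map_sum]
    apply Submodule.sum_mem
    intro σ hσ
    have h1 : σ.degree ≤ d := by
      have := MvPolynomial.le_totalDegree hσ
      exact le_trans (le_of_eq rfl) (this.trans hp)
    have h2 : MvPolynomial.monomial σ (p.coeff σ) = p.coeff σ • MvPolynomial.monomial σ 1 := by
      rw [MvPolynomial.smul_monomial, smul_eq_mul, mul_one]
    rw [h2, map_smul]
    apply Submodule.smul_mem
    refine Submodule.map_mono ?_ (monom_mem k E hk N hN _ σ rfl)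
    apply iSup_le
    intro j
    exact (SG k hk N hN).L_le_Lle (by omega)
  · rw [LData.Lle, Submodule.map_iSup, iSup_le_iff]
    rintro i f ⟨v, hv, rfl⟩
    have hv : v ∈ Lg k i := hv
    rw [Phi_eq_eval]
    refine ⟨_, ?_, rfl⟩
    apply Submodule.sum_mem
    intro a _
    by_cases ha : ∑ j, a j = i
    · rw [MvPolynomial.mem_restrictTotalDegree]
      refine (MvPolynomial.totalDegree_mul _ _).trans ?_
      rw [MvPolynomial.totalDegree_C, zero_add]
      refine (PP_deg k a).trans ?_
      omega
    · rw [hv a ha]; simp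

theorem hilbert_formula (E : Finset ℕ) (d : ℕ) :
    hilbertFn n (underlineR n k (E : Set ℕ)) d =
      ∑ i ∈ Finset.range (N+1), Module.finrank ℝ ((SG k hk N hN).H i) *
        min (d + 1 - i) (E.filter (fun e => i ≤ e ∧ e + i ≤ N)).card := by
  unfold hilbertFn
  rw [map_eval_eq k E hk N hN]
  apply (SG k hk N hN).finrank_main (fun x => ∑ i, nv x.1 i)
  · intro i v hv x
    exact Phi_U k E i v hv x
  · intro x
    exact_mod_cast wt_nv k x.2
  · intro e he v hv h
    exact Phi_inj k E e (by exact_mod_cast he) v hv h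

theorem layer_formula (j : ℕ) :
    layerCard n k j =
      ∑ i ∈ Finset.range (N+1), Module.finrank ℝ ((SG k hk N hN).H i) *
        (if i ≤ j ∧ j + i ≤ N then 1 else 0) := by
  let E : Finset ℕ := {j}
  have hmain := (SG k hk N hN).finrank_main (X := underlineR n k (E : Set ℕ))
    (fun x => ∑ i, nv x.1 i) (Phi k E)
    (fun i v hv x => Phi_U k E i v hv x) E (fun x => by exact_mod_cast wt_nv k x.2)
    (fun e he v hv h => Phi_inj k E e (by exact_mod_cast he) v hv h) (max N j)
  have hwt : ∀ x : underlineR n k (E : Set ℕ), ∑ i, nv x.1 i = j := by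
    intro x
    simpa [E] using wt_nv k x.2
  have htop : ((SG k hk N hN).Lle (max N j)).map (Phi k (E : Set ℕ)) = ⊤ := by
    rw [eq_top_iff]
    intro f _
    let v : MG k := ⟨fun b => if h : (fun i => (b i : ℝ)) ∈ underlineR n k (E : Set ℕ) then
      f ⟨_, h⟩ / pf k b b else 0, by
        intro b hb
        apply dif_neg
        intro h
        apply hb
        have := gr_nv k h.1
        rwa [nv_cast] at this⟩
    have hv : v ∈ Lg k j := by
      intro b hb
      apply dif_neg
      intro h
      apply hb
      have := hwt ⟨_, h⟩
      simpa [nv_cast] using this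
    refine ⟨v, (SG k hk N hN).L_le_Lle (le_max_right _ _) hv, ?_⟩
    funext x
    rw [Phi_layer k _ v j hv x (hwt x)]
    have hx : v.1 (nv x.1) = f x / pf k (nv x.1) (nv x.1) := by
      have hc := cast_nv k x.2.1
      have hm : (fun i => (nv x.1 i : ℝ)) ∈ underlineR n k (E : Set ℕ) := by
        rw [hc]; exact x.2
      refine (dif_pos hm).trans ?_
      congr 2
      exact Subtype.ext hc
    rw [hx, div_mul_cancel₀ _ (pf_self_ne k _)]
  have hcard : Module.finrank ℝ (underlineR n k (E : Set ℕ) → ℝ) = layerCard n k j := by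
    let g : {x : ∀ i, Fin (k i) // ∑ i, (x i : ℕ) = j} → underlineR n k (E : Set ℕ) :=
      fun x => ⟨fun i => ((x.1 i : ℕ) : ℝ),
        cast_mem k (b := fun i => (x.1 i : ℕ)) (fun i => (x.1 i).2) (by simp [E, x.2])⟩
    have hg : Function.Bijective g := by
      constructor
      · intro x y h
        apply Subtype.ext
        funext i
        have : ((x.1 i : ℕ) : ℝ) = ((y.1 i : ℕ) : ℝ) := congrFun (congrArg Subtype.val h) i
        apply Fin.ext
        exact_mod_cast this
      · intro x
        refine ⟨⟨fun i => ⟨nv x.1 i, gr_nv k x.2.1 i⟩, hwt x⟩, ?_⟩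
        apply Subtype.ext
        exact cast_nv k x.2.1
    let eq := Equiv.ofBijective g hg
    letI : Fintype (underlineR n k (E : Set ℕ)) := Fintype.ofEquiv _ eq
    rw [Module.finrank_fintype_fun_eq_card, Fintype.card_congr eq.symm, Fintype.card_subtype]
    rfl
  rw [htop, finrank_top, hcard] at hmain
  rw [hmain]
  apply Finset.sum_congr rfl
  intro i hi
  rw [Finset.mem_range] at hi
  congr 1
  by_cases h : i ≤ j ∧ j + i ≤ N
  · rw [if_pos h, Finset.filter_true_of_mem (by intro e he; rw [Finset.mem_singleton.mp he]; exact h)]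
    simp only [E, Finset.card_singleton]
    omega
  · rw [if_neg h, Finset.filter_false_of_mem (by intro e he; rw [Finset.mem_singleton.mp he]; exact h)]
    simp

end concrete
end

lemma sort_lt_iff (S : Finset ℕ) (p : ℕ) (hp : p < S.card) (M : ℕ) :
    (S.sort (· ≤ ·)).getD p 0 < M ↔ p < (S.filter (· < M)).card := by
  let f := S.orderEmbOfFin rfl
  have hf : (S.sort (· ≤ ·)).getD p 0 = f ⟨p, hp⟩ := by
    rw [Finset.orderEmbOfFin_apply, List.getD_eq_getElem]
    rfl
  rw [hf]
  constructor
  · intro h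
    have hsub : (Finset.univ.filter (fun q : Fin S.card => q ≤ ⟨p, hp⟩)).image f ⊆
        S.filter (· < M) := by
      intro x hx
      obtain ⟨q, hq, rfl⟩ := Finset.mem_image.mp hx
      rw [Finset.mem_filter]
      refine ⟨S.orderEmbOfFin_mem rfl q, lt_of_le_of_lt ?_ h⟩
      exact f.monotone (Finset.mem_filter.mp hq).2
    have := Finset.card_le_card hsub
    rw [Finset.card_image_of_injective _ f.injective] at this
    have h2 : (Finset.univ.filter (fun q : Fin S.card => q ≤ ⟨p, hp⟩)).card = p + 1 := by
      have : Finset.univ.filter (fun q : Fin S.card => q ≤ ⟨p, hp⟩) = Finset.Iic ⟨p, hp⟩ := by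
        ext q; simp
      rw [this, Fin.card_Iic]
    omega
  · intro h
    by_contra hlt
    have hsub : S.filter (· < M) ⊆
        (Finset.univ.filter (fun q : Fin S.card => q < ⟨p, hp⟩)).image f := by
      intro x hx
      rw [Finset.mem_filter] at hx
      have : x ∈ Set.range f := by
        rw [Finset.range_orderEmbOfFin]; exact hx.1
      obtain ⟨q, rfl⟩ := this
      refine Finset.mem_image.mpr ⟨q, ?_, rfl⟩
      rw [Finset.mem_filter]
      refine ⟨Finset.mem_univ _, ?_⟩
      apply f.lt_iff_lt.mp
      omega
    have := Finset.card_le_card hsub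
    rw [Finset.card_image_of_injective _ f.injective] at this
    have h2 : (Finset.univ.filter (fun q : Fin S.card => q < ⟨p, hp⟩)).card = p := by
      have : Finset.univ.filter (fun q : Fin S.card => q < ⟨p, hp⟩) = Finset.Iio ⟨p, hp⟩ := by
        ext q; simp
      rw [this, Fin.card_Iio]
    omega

lemma sort_mem (S : Finset ℕ) (p : ℕ) (hp : p < S.card) :
    (S.sort (· ≤ ·)).getD p 0 ∈ S := by
  rw [List.getD_eq_getElem _ _ (by simpa using hp)]
  exact (Finset.mem_sort _).mp (List.getElem_mem _)

lemma per_i (N d : ℕ) (hd : d ≤ N) (E : Finset ℕ)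
    (T W : Finset ℕ) (hT : T = (Finset.Icc 0 d) \ E) (hW : W = E \ (Finset.Icc 0 d)) (i : ℕ) :
    min (d + 1 - i) (E.filter (fun e => i ≤ e ∧ e + i ≤ N)).card =
      (∑ w ∈ E ∩ Finset.Icc 0 d, if i ≤ w ∧ w + i ≤ N then 1 else 0) +
      ∑ j ∈ Finset.Icc 1 (min T.card W.card),
        min (if i ≤ (T.sort (· ≤ ·)).getD (T.card - j) 0 ∧
              (T.sort (· ≤ ·)).getD (T.card - j) 0 + i ≤ N then 1 else 0)
            (if i ≤ (W.sort (· ≤ ·)).getD (j - 1) 0 ∧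
              (W.sort (· ≤ ·)).getD (j - 1) 0 + i ≤ N then 1 else 0) := by
  have hT1 : ∀ j ∈ Finset.Icc 1 (min T.card W.card), (T.sort (· ≤ ·)).getD (T.card - j) 0 ≤ d := by
    intro j hj
    rw [Finset.mem_Icc] at hj
    have := sort_mem T (T.card - j) (by omega)
    have h2 : ∀ x ∈ T, x ≤ d := by
      intro x hx
      rw [hT] at hx
      simp at hx
      exact hx.1
    exact h2 _ this
  have hW1 : ∀ j ∈ Finset.Icc 1 (min T.card W.card), d < (W.sort (· ≤ ·)).getD (j - 1) 0 := by
    intro j hj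
    rw [Finset.mem_Icc] at hj
    have := sort_mem W (j - 1) (by omega)
    have h2 : ∀ x ∈ W, d < x := by
      intro x hx
      rw [hW] at hx
      simp at hx
      exact hx.2
    exact h2 _ this
  rw [← Finset.card_filter]
  by_cases hid : d < i
  · have e0 : (E ∩ Finset.Icc 0 d).filter (fun w => i ≤ w ∧ w + i ≤ N) = ∅ := by
      apply Finset.filter_false_of_mem
      intro w hw
      simp at hw
      omega
    rw [e0, Finset.sum_eq_zero]
    · have : d + 1 - i = 0 := by omega
      simp [this]
    · intro j hj
      have := hT1 j hj
      rw [if_neg (by omega)]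
      simp
  by_cases hdN : N < d + i
  · rw [Finset.sum_eq_zero]
    · have e : E.filter (fun e => i ≤ e ∧ e + i ≤ N) =
          (E ∩ Finset.Icc 0 d).filter (fun w => i ≤ w ∧ w + i ≤ N) := by
        ext x
        simp
        omega
      rw [← e, add_zero]
      apply min_eq_right
      have : E.filter (fun e => i ≤ e ∧ e + i ≤ N) ⊆ Finset.Icc i d := by
        intro x hx
        simp at hx ⊢
        omega
      have := Finset.card_le_card this
      simp at this
      exact this
    · intro j hj
      have := hW1 j hj
      rw [if_neg (c := _ ≤ (W.sort (· ≤ ·)).getD (j - 1) 0 ∧ _) (by omega)]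
      simp
  -- main case
  set a := (T.filter (fun t => ¬ t < i)).card with ha
  set c := (W.filter (· < N - i + 1)).card with hc
  have hsumT : (T.filter (· < i)).card + a = T.card :=
    Finset.card_filter_add_card_filter_not (s := T) (fun t => t < i)
  have hcW : c ≤ W.card := Finset.card_filter_le _ _
  have h1 : ∑ j ∈ Finset.Icc 1 (min T.card W.card),
        min (if i ≤ (T.sort (· ≤ ·)).getD (T.card - j) 0 ∧
              (T.sort (· ≤ ·)).getD (T.card - j) 0 + i ≤ N then 1 else 0)
            (if i ≤ (W.sort (· ≤ ·)).getD (j - 1) 0 ∧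
              (W.sort (· ≤ ·)).getD (j - 1) 0 + i ≤ N then 1 else 0) = min a c := by
    have hone : ∑ j ∈ Finset.Icc 1 (min a c), 1 = min a c := by simp
    refine Eq.trans ?_ hone
    rw [← Finset.sum_subset (s₁ := Finset.Icc 1 (min a c))]
    · apply Finset.sum_congr rfl
      intro j hj
      rw [Finset.mem_Icc] at hj
      have hj' : j ∈ Finset.Icc 1 (min T.card W.card) := by
        rw [Finset.mem_Icc]; omega
      have t1 := sort_lt_iff T (T.card - j) (by omega) i
      have t2 := sort_lt_iff W (j - 1) (by omega) (N - i + 1)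
      have t3 := hT1 j hj'
      have t4 := hW1 j hj'
      rw [if_pos (by omega), if_pos (by omega)]
      rfl
    · intro j hj
      rw [Finset.mem_Icc] at hj ⊢
      omega
    · intro j hj' hj
      have t3 := hT1 j hj'
      have t4 := hW1 j hj'
      rw [Finset.mem_Icc] at hj hj'
      have t1 := sort_lt_iff T (T.card - j) (by omega) i
      have t2 := sort_lt_iff W (j - 1) (by omega) (N - i + 1)
      by_cases hja : j ≤ a
      · rw [if_neg (c := _ ≤ (W.sort (· ≤ ·)).getD (j - 1) 0 ∧ _) (by omega)]
        simp
      · rw [if_neg (by omega)]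
        simp
  rw [h1]
  set b := ((E ∩ Finset.Icc 0 d).filter (fun w => i ≤ w ∧ w + i ≤ N)).card with hb
  have e1 : a + b = d + 1 - i := by
    rw [ha, hb, ← Finset.card_union_of_disjoint]
    · rw [← Nat.card_Icc]
      congr 1
      ext x
      rw [hT]
      simp
      by_cases hx : x ∈ E <;> simp [hx] <;> omega
    · rw [Finset.disjoint_left]
      intro x hx
      rw [hT] at hx
      simp at hx ⊢
      tauto
  have e2 : c + b = (E.filter (fun e => i ≤ e ∧ e + i ≤ N)).card := by
    rw [hc, hb, ← Finset.card_union_of_disjoint]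
    · congr 1
      ext x
      rw [hW]
      simp
      by_cases hx : x ∈ E <;> simp [hx] <;> omega
    · rw [Finset.disjoint_left]
      intro x hx
      rw [hW] at hx
      simp at hx ⊢
      omega
  omega

lemma min_sum (N : ℕ) (h : ℕ → ℕ) (t w : ℕ) (ht : t ≤ N) (hw : w ≤ N) :
    min (∑ i ∈ Finset.range (N+1), h i * (if i ≤ t ∧ t + i ≤ N then 1 else 0))
      (∑ i ∈ Finset.range (N+1), h i * (if i ≤ w ∧ w + i ≤ N then 1 else 0)) =
    ∑ i ∈ Finset.range (N+1), h i * min (if i ≤ t ∧ t + i ≤ N then 1 else 0)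
      (if i ≤ w ∧ w + i ≤ N then 1 else 0) := by
  have key : ∀ t w : ℕ, t ≤ N → w ≤ N → min t (N - t) ≤ min w (N - w) → ∀ i,
      (if i ≤ t ∧ t + i ≤ N then 1 else 0) ≤ (if i ≤ w ∧ w + i ≤ N then 1 else 0) := by
    intro t w ht hw hle i
    split_ifs <;> omega
  rcases le_total (min t (N - t)) (min w (N - w)) with hle | hle
  · have := key t w ht hw hle
    rw [min_eq_left (Finset.sum_le_sum fun i _ => Nat.mul_le_mul_left _ (this i))]
    exact Finset.sum_congr rfl fun i _ => by rw [min_eq_left (this i)]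
  · have := key w t hw ht hle
    rw [min_eq_right (Finset.sum_le_sum fun i _ => Nat.mul_le_mul_left _ (this i))]
    exact Finset.sum_congr rfl fun i _ => by rw [min_eq_right (this i)]

/-- Affine Hilbert functions of general weight-determined sets.  With the `(N,d)`-BE
enumeration `[0,d] ∖ E = {t_ℓ < ⋯ < t₁}` and `E ∖ [0,d] = {w₁ < ⋯ < w_r}`,
`H_d(E̲) = ∑_{w ∈ E ∩ [0,d]} [G choose w]
  + ∑_{j=1}^{min{ℓ,r}} min{[G choose t_j], [G choose w_j]}`.
Here `t_j` is the `j`-th largest element of `[0,d] ∖ E` and `w_j` the `j`-th smallest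
element of `E ∖ [0,d]`, read off from the increasing sorted lists. -/
theorem stmt_14 (n : ℕ) (k : Fin n → ℕ) (hk : ∀ i, 2 ≤ k i)
    (N : ℕ) (hN : N = ∑ i, (k i - 1)) (d : ℕ) (hd : d ≤ N)
    (E : Finset ℕ) (hE : ∀ e ∈ E, e ≤ N)
    (T W : Finset ℕ) (hT : T = (Finset.Icc 0 d) \ E) (hW : W = E \ (Finset.Icc 0 d)) :
    hilbertFn n (underlineR n k ↑E) d =
      (∑ w ∈ E ∩ Finset.Icc 0 d, layerCard n k w) +
      ∑ j ∈ Finset.Icc 1 (min T.card W.card),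
        min (layerCard n k ((T.sort (· ≤ ·)).getD (T.card - j) 0))
            (layerCard n k ((W.sort (· ≤ ·)).getD (j - 1) 0)) := by
  have hTN : ∀ x ∈ T, x ≤ N := by
    intro x hx
    rw [hT] at hx
    simp at hx
    omega
  have hWN : ∀ x ∈ W, x ≤ N := by
    intro x hx
    rw [hW] at hx
    exact hE x (Finset.mem_sdiff.mp hx).1
  have h1 : ∀ j ∈ Finset.Icc 1 (min T.card W.card),
      min (layerCard n k ((T.sort (· ≤ ·)).getD (T.card - j) 0))
            (layerCard n k ((W.sort (· ≤ ·)).getD (j - 1) 0)) =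
      ∑ i ∈ Finset.range (N+1), Module.finrank ℝ ((SG k hk N hN).H i) *
        min (if i ≤ (T.sort (· ≤ ·)).getD (T.card - j) 0 ∧
              (T.sort (· ≤ ·)).getD (T.card - j) 0 + i ≤ N then 1 else 0)
            (if i ≤ (W.sort (· ≤ ·)).getD (j - 1) 0 ∧
              (W.sort (· ≤ ·)).getD (j - 1) 0 + i ≤ N then 1 else 0) := by
    intro j hj
    rw [Finset.mem_Icc] at hj
    rw [layer_formula k hk N hN, layer_formula k hk N hN]
    exact min_sum N (fun i => Module.finrank ℝ ((SG k hk N hN).H i)) _ _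
      (hTN _ (sort_mem T _ (by omega))) (hWN _ (sort_mem W _ (by omega)))
  rw [Finset.sum_congr rfl h1,
    Finset.sum_congr rfl (fun w (_ : w ∈ E ∩ Finset.Icc 0 d) => layer_formula k hk N hN w),
    Finset.sum_comm, Finset.sum_comm (s := Finset.Icc 1 (min T.card W.card)),
    ← Finset.sum_add_distrib, hilbert_formula k hk N hN E d]
  apply Finset.sum_congr rfl
  intro i _
  rw [← Finset.mul_sum, ← Finset.mul_sum, ← mul_add, per_i N d hd E T W hT hW i]
end
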